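/- Let W be a discrete memoryless channel from a finite alphabet 𝒳 to a finite alphabet 𝒴, let 0 < ε, δ < 1 with ε + δ < 1 and V_{ε+δ}(W) > 0, and let a ∈ ℝ be the real number with Φ(a) = ε + δ, where Φ is the standard normal cumulative distribution function. Then there exist a constant F > 0 and n_0 ∈ ℕ such that for all n ≥ n_0, setting η_n = 1/√n, there exists a distribution Q_n on 𝒴^n with max_{x^n ∈ 𝒳^n} D_s^{ε+δ+η_n}(W^n(·|x^n) ‖ Q_n) ≤ n·C(W) + √(n·V_{ε+δ}(W))·a + F. -/

import Mathlib

open Finset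

/-- `p` is a probability distribution on a finite type. -/
def IsDist {Z : Type*} [Fintype Z] (p : Z → ℝ) : Prop :=
  (∀ z, 0 ≤ p z) ∧ ∑ z, p z = 1

/-- `W` is a channel from `A` to `B`. -/
def IsChannel {A B : Type*} [Fintype A] [Fintype B] (W : A → B → ℝ) : Prop :=
  (∀ x y, 0 ≤ W x y) ∧ ∀ x, ∑ y, W x y = 1

/-- Output distribution `PW`. -/
noncomputable def outDist {A B : Type*} [Fintype A] (P : A → ℝ) (W : A → B → ℝ) (y : B) : ℝ :=
  ∑ x, P x * W x y

/-- Mass of a set under a (sub)distribution. -/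
noncomputable def mass {Z : Type*} [Fintype Z] (p : Z → ℝ) (S : Set Z) : ℝ :=
  ∑ z, S.indicator p z

/-- `P×W(S)`. -/
noncomputable def jointMass {A B : Type*} [Fintype A] [Fintype B]
    (P : A → ℝ) (W : A → B → ℝ) (S : Set (A × B)) : ℝ :=
  mass (fun z : A × B => P z.1 * W z.1 z.2) S

/-- Variational distance between (sub)distributions. -/
noncomputable def tvDist {Z : Type*} [Fintype Z] (p q : Z → ℝ) : ℝ :=
  (1 / 2) * ∑ z, |p z - q z|

/-- Partial response `PW^S`. -/
noncomputable def partialResp {A B : Type*} [Fintype A] [Fintype B]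
    (P : A → ℝ) (W : A → B → ℝ) (S : Set (A × B)) (y : B) : ℝ :=
  ∑ x, S.indicator (fun z : A × B => P z.1 * W z.1 z.2) (x, y)

/-- `p` is an `M`-type: every value is an integer multiple of `1/M`. -/
def IsMType {Z : Type*} [Fintype Z] (M : ℕ) (p : Z → ℝ) : Prop :=
  ∀ z, ∃ k : ℕ, p z = (k : ℝ) / M

/-- `(N, ε, δ)`-ID code for channel `W`. -/
structure IsIDCode {A B : Type*} [Fintype A] [Fintype B] (W : A → B → ℝ) (N : ℕ)
    (P : Fin N → A → ℝ) (D : Fin N → Set B) (ε δ : ℝ) : Prop where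
  dist : ∀ i, IsDist (P i)
  typeI : ∀ i, mass (outDist (P i) W) (D i)ᶜ ≤ ε
  typeII : ∀ i j, i ≠ j → mass (outDist (P i) W) (D j) ≤ δ

/-- Existence of an `(N, ε, δ)`-ID code for channel `W`. -/
def ExistsIDCode {A B : Type*} [Fintype A] [Fintype B] (W : A → B → ℝ) (N : ℕ) (ε δ : ℝ) : Prop :=
  ∃ (P : Fin N → A → ℝ) (D : Fin N → Set B), IsIDCode W N P D ε δ

/-- `ε`-information spectrum divergence `D_s^ε(p‖q)`. -/
noncomputable def Ds {Z : Type*} [Fintype Z] (α : ℝ) (p q : Z → ℝ) : ℝ :=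
  sSup {γ : ℝ | mass p {z | p z ≤ Real.exp γ * q z} ≤ α}

/-- Optimal type II error `β_ε(p,q)` of binary hypothesis testing. -/
noncomputable def betaErr {Z : Type*} [Fintype Z] (ε : ℝ) (p q : Z → ℝ) : ℝ :=
  sInf {v : ℝ | ∃ t : Z → ℝ, (∀ z, 0 ≤ t z ∧ t z ≤ 1) ∧
    (∑ z, p z * (1 - t z)) ≤ ε ∧ v = ∑ z, q z * t z}
/-- Mutual information `I(P, W)`. -/
noncomputable def mutInfo {𝒳 𝒴 : Type*} [Fintype 𝒳] [Fintype 𝒴]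
    (P : 𝒳 → ℝ) (W : 𝒳 → 𝒴 → ℝ) : ℝ :=
  ∑ x, ∑ y, P x * W x y * Real.log (W x y / outDist P W y)

/-- Shannon capacity `C(W)`. -/
noncomputable def capacity {𝒳 𝒴 : Type*} [Fintype 𝒳] [Fintype 𝒴] (W : 𝒳 → 𝒴 → ℝ) : ℝ :=
  sSup {c : ℝ | ∃ P : 𝒳 → ℝ, IsDist P ∧ c = mutInfo P W}

/-- `P` is a capacity-achieving input distribution for `W`. -/
def CapacityAchieving {𝒳 𝒴 : Type*} [Fintype 𝒳] [Fintype 𝒴]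
    (P : 𝒳 → ℝ) (W : 𝒳 → 𝒴 → ℝ) : Prop :=
  IsDist P ∧ mutInfo P W = capacity W

/-- `D(W(·|x)‖Q)`. -/
noncomputable def divX {𝒳 𝒴 : Type*} [Fintype 𝒴] (W : 𝒳 → 𝒴 → ℝ) (Q : 𝒴 → ℝ) (x : 𝒳) : ℝ :=
  ∑ y, W x y * Real.log (W x y / Q y)

/-- Conditional information variance `V(W‖Q|P)`. -/
noncomputable def condInfoVar {𝒳 𝒴 : Type*} [Fintype 𝒳] [Fintype 𝒴]
    (W : 𝒳 → 𝒴 → ℝ) (Q : 𝒴 → ℝ) (P : 𝒳 → ℝ) : ℝ :=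
  ∑ x, P x * ∑ y, W x y * (Real.log (W x y / Q y) - divX W Q x) ^ 2

/-- `V_min(W)`: minimum conditional information variance over capacity-achieving input
distributions, evaluated at the (unique) capacity-achieving output distribution. -/
noncomputable def Vmin {𝒳 𝒴 : Type*} [Fintype 𝒳] [Fintype 𝒴] (W : 𝒳 → 𝒴 → ℝ) : ℝ :=
  sInf {v : ℝ | ∃ P : 𝒳 → ℝ, CapacityAchieving P W ∧ v = condInfoVar W (outDist P W) P}

/-- `V_max(W)`. -/
noncomputable def Vmax {𝒳 𝒴 : Type*} [Fintype 𝒳] [Fintype 𝒴] (W : 𝒳 → 𝒴 → ℝ) : ℝ :=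
  sSup {v : ℝ | ∃ P : 𝒳 → ℝ, CapacityAchieving P W ∧ v = condInfoVar W (outDist P W) P}

/-- The `α`-dispersion `V_α(W)`. -/
noncomputable def Vdisp {𝒳 𝒴 : Type*} [Fintype 𝒳] [Fintype 𝒴] (α : ℝ) (W : 𝒳 → 𝒴 → ℝ) : ℝ :=
  if α < 1 / 2 then Vmin W else Vmax W

/-- `n`-fold memoryless extension `W^n` of a DMC `W`. -/
noncomputable def prodChannel {𝒳 𝒴 : Type*} [Fintype 𝒳] [Fintype 𝒴]
    (W : 𝒳 → 𝒴 → ℝ) (n : ℕ) : (Fin n → 𝒳) → (Fin n → 𝒴) → ℝ :=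
  fun xs ys => ∏ k, W (xs k) (ys k)

/-- `L` is an `(ε,δ)`-achievable second-order ID rate for the DMC `W`. -/
def AchievableSecondOrderIDRate {𝒳 𝒴 : Type*} [Fintype 𝒳] [Fintype 𝒴]
    (W : 𝒳 → 𝒴 → ℝ) (ε δ L : ℝ) : Prop :=
  ∃ (N : ℕ → ℕ) (e d : ℕ → ℝ),
    (∀ n, 1 ≤ n → ExistsIDCode (prodChannel W n) (N n) (e n) (d n)) ∧
    Filter.limsup e Filter.atTop ≤ ε ∧
    Filter.limsup d Filter.atTop ≤ δ ∧
    L ≤ Filter.liminf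
        (fun n : ℕ => (Real.log (Real.log (N n)) - n * capacity W) / Real.sqrt n)
        Filter.atTop

/-- Standard normal cumulative distribution function `Φ`. -/
noncomputable def stdPhi (a : ℝ) : ℝ :=
  ∫ t in Set.Iic a, Real.exp (-t ^ 2 / 2) / Real.sqrt (2 * Real.pi)

lemma exists_between_of_finite {ι : Type*} [Fintype ι] (S T : ι → Prop) (t : ι → ℝ)
    (h : ∀ i j, S i → T j → t i ≤ t j) :
    ∃ c : ℝ, (∀ i, S i → t i ≤ c) ∧ ∀ j, T j → c ≤ t j := by
  classical
  by_cases hS : ∃ i, S i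
  · have hne : (univ.filter S).Nonempty := by
      obtain ⟨i, hi⟩ := hS
      exact ⟨i, by simpa using hi⟩
    refine ⟨(univ.filter S).sup' hne t, fun i hi => ?_, fun j hj => ?_⟩
    · exact le_sup' t (by simpa using hi)
    · exact sup'_le _ _ fun i hi => h i j (by simpa using hi) hj
  · by_cases hT : ∃ j, T j
    · have hne : (univ.filter T).Nonempty := by
        obtain ⟨i, hi⟩ := hT
        exact ⟨i, by simpa using hi⟩
      refine ⟨(univ.filter T).inf' hne t, fun i hi => (hS ⟨i, hi⟩).elim, fun j hj => ?_⟩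
      exact inf'_le t (by simpa using hj)
    · exact ⟨0, fun i hi => (hS ⟨i, hi⟩).elim, fun i hi => (hT ⟨i, hi⟩).elim⟩

/-- Gale's theorem of the alternative, by Fourier–Motzkin elimination. -/
lemma exists_multipliers_fin (m : ℕ) : ∀ {ι : Type*} [Fintype ι] (a : ι → Fin m → ℝ) (b : ι → ℝ),
    (∀ p : ι → ℝ, (∀ i, 0 ≤ p i) → (∀ j, ∑ i, p i * a i j = 0) → ∑ i, p i * b i ≤ 0) →
    ∃ l : Fin m → ℝ, ∀ i, b i ≤ ∑ j, l j * a i j := by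
  classical
  induction m with
  | zero =>
    intro ι _ a b h
    refine ⟨0, fun i => ?_⟩
    have := h (Pi.single i 1) (fun k => by
      by_cases hk : k = i
      · subst hk; simp
      · simp [hk]) (fun j => j.elim0)
    simpa [Pi.single_apply] using this
  | succ m ih =>
    intro ι _ a b h
    let c : ι ⊕ (ι × ι) → ι → ℝ := fun k i => match k with
      | .inl u => if a u 0 = 0 ∧ i = u then 1 else 0
      | .inr (u, v) => if 0 < a u 0 ∧ a v 0 < 0 then
          (if i = u then - a v 0 else 0) + (if i = v then a u 0 else 0) else 0
    have hc : ∀ k i, 0 ≤ c k i := by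
      rintro (u | ⟨u, v⟩) i
      · simp only [c]; split_ifs <;> norm_num
      · simp only [c]; split_ifs <;> linarith
    have cl : ∀ u, a u 0 = 0 → ∀ g : ι → ℝ, ∑ i, c (.inl u) i * g i = g u := by
      intro u hu g
      simp [c, hu]
    have cr : ∀ u v, 0 < a u 0 → a v 0 < 0 → ∀ g : ι → ℝ,
        ∑ i, c (.inr (u, v)) i * g i = - a v 0 * g u + a u 0 * g v := by
      intro u v hu hv g
      simp [c, hu, hv, add_mul, sum_add_distrib]
    have c0 : ∀ k, ∑ i, c k i * a i 0 = 0 := by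
      rintro (u | ⟨u, v⟩)
      · by_cases hu : a u 0 = 0
        · rw [cl u hu, hu]
        · simp [c, hu]
      · by_cases huv : 0 < a u 0 ∧ a v 0 < 0
        · rw [cr u v huv.1 huv.2]; ring
        · simp [c, huv]
    have key : ∀ (p : ι ⊕ (ι × ι) → ℝ) (g : ι → ℝ),
        ∑ i, (∑ k, p k * c k i) * g i = ∑ k, p k * ∑ i, c k i * g i := by
      intro p g
      simp_rw [sum_mul, mul_sum]
      rw [sum_comm]
      simp_rw [mul_assoc]
    obtain ⟨l, hl⟩ := ih (fun k j => ∑ i, c k i * a i j.succ) (fun k => ∑ i, c k i * b i) (by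
      intro p hp hpa
      have := h (fun i => ∑ k, p k * c k i)
        (fun i => sum_nonneg fun k _ => mul_nonneg (hp k) (hc k i)) (fun j => by
          rw [key p fun i => a i j]
          refine Fin.cases ?_ (fun j => ?_) j
          · simp [c0]
          · exact hpa j)
      rwa [key] at this)
    have hl' : ∀ k, ∑ i, c k i * b i ≤ ∑ i, c k i * ∑ j, l j * a i j.succ := by
      intro k
      refine (hl k).trans (le_of_eq ?_)
      simp_rw [mul_sum]
      rw [sum_comm]
      refine sum_congr rfl fun i _ => sum_congr rfl fun j _ => by ring
    set s : ι → ℝ := fun i => ∑ j, l j * a i j.succ with hs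
    obtain ⟨d, hd1, hd2⟩ := exists_between_of_finite (fun i => 0 < a i 0) (fun i => a i 0 < 0)
      (fun i => (b i - s i) / a i 0) (by
        intro u v hu hv
        have := hl' (.inr (u, v))
        rw [cr u v hu hv, cr u v hu hv] at this
        rw [div_le_iff₀ hu, div_mul_eq_mul_div, le_div_iff_of_neg hv]
        nlinarith)
    refine ⟨Fin.cons d l, fun i => ?_⟩
    rw [Fin.sum_univ_succ]
    simp only [Fin.cons_zero, Fin.cons_succ]
    change b i ≤ d * a i 0 + s i
    rcases lt_trichotomy (a i 0) 0 with h0 | h0 | h0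
    · have := hd2 i h0
      rw [le_div_iff_of_neg h0] at this
      linarith
    · have := hl' (.inl i)
      rw [cl i h0, cl i h0] at this
      rw [h0]; linarith
    · have := hd1 i h0
      rw [div_le_iff₀ h0] at this
      linarith

lemma exists_multipliers {ι κ : Type*} [Fintype ι] [Fintype κ] (a : ι → κ → ℝ) (b : ι → ℝ)
    (h : ∀ p : ι → ℝ, (∀ i, 0 ≤ p i) → (∀ j, ∑ i, p i * a i j = 0) → ∑ i, p i * b i ≤ 0) :
    ∃ l : κ → ℝ, ∀ i, b i ≤ ∑ j, l j * a i j := by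
  let e := Fintype.equivFin κ
  obtain ⟨l, hl⟩ := exists_multipliers_fin _ (fun i j => a i (e.symm j)) b
    (fun p hp hpa => h p hp fun j => by simpa using hpa (e j))
  refine ⟨fun k => l (e k), fun i => (hl i).trans (le_of_eq ?_)⟩
  exact Fintype.sum_equiv e.symm _ _ (by simp)
/-- Density of the standard normal distribution. -/
noncomputable def stdDensity (t : ℝ) : ℝ :=
  Real.exp (-t ^ 2 / 2) / Real.sqrt (2 * Real.pi)

lemma stdDensity_pos (t : ℝ) : 0 < stdDensity t := by
  unfold stdDensity; positivity

lemma continuous_stdDensity : Continuous stdDensity := by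
  unfold stdDensity; fun_prop

lemma stdDensity_neg (t : ℝ) : stdDensity (-t) = stdDensity t := by
  simp [stdDensity]

lemma integrable_stdDensity : MeasureTheory.Integrable stdDensity := by
  have := (integrable_exp_neg_mul_sq (b := 1 / 2) (by norm_num)).div_const (Real.sqrt (2 * Real.pi))
  refine this.congr (Filter.Eventually.of_forall fun t => ?_)
  simp only [stdDensity]
  congr 2; ring

lemma integral_stdDensity : ∫ t, stdDensity t = 1 := by
  have h : ∀ t, stdDensity t = Real.exp (-(1 / 2) * t ^ 2) / Real.sqrt (2 * Real.pi) := by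
    intro t
    simp only [stdDensity]
    congr 2; ring
  simp_rw [h]
  rw [MeasureTheory.integral_div, integral_gaussian]
  rw [show Real.pi / (1 / 2) = 2 * Real.pi by ring]
  exact div_self (by positivity)

lemma hasDerivAt_stdDensity (t : ℝ) : HasDerivAt stdDensity (-t * stdDensity t) t := by
  have h1 : HasDerivAt (fun t : ℝ => -t ^ 2 / 2) (-t) t := by
    have := ((hasDerivAt_pow 2 t).neg).div_const 2
    convert! this using 1
    simp; ring
  have := h1.exp.div_const (Real.sqrt (2 * Real.pi))
  convert! this using 1
  simp only [stdDensity]; ring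

lemma one_sub_stdPhi (a : ℝ) : 1 - stdPhi a = ∫ t in Set.Ioi a, stdDensity t := by
  have := MeasureTheory.integral_add_compl (s := Set.Iic a) measurableSet_Iic integrable_stdDensity
  rw [integral_stdDensity, Set.compl_Iic] at this
  rw [← this]
  simp [stdPhi, stdDensity]

lemma stdPhi_neg (a : ℝ) : stdPhi (-a) = 1 - stdPhi a := by
  rw [one_sub_stdPhi]
  have := integral_comp_neg_Iic (-a) stdDensity
  simp only [stdDensity_neg, neg_neg] at this
  rw [← this]; rfl

lemma stdPhi_nonneg (a : ℝ) : 0 ≤ stdPhi a :=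
  MeasureTheory.integral_nonneg fun t => (stdDensity_pos t).le

lemma stdPhi_le_one (a : ℝ) : stdPhi a ≤ 1 := by
  have := stdPhi_nonneg (-a)
  rw [stdPhi_neg] at this
  linarith

lemma hasDerivAt_stdPhi (a : ℝ) : HasDerivAt stdPhi (stdDensity a) a := by
  have h : stdPhi = fun x => stdPhi 0 + ∫ t in (0 : ℝ)..x, stdDensity t := by
    ext x
    rw [intervalIntegral.integral_Iic_sub_Iic integrable_stdDensity.integrableOn
      integrable_stdDensity.integrableOn |>.symm]
    simp [stdPhi, stdDensity]
  rw [h]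
  exact (continuous_stdDensity.integral_hasStrictDerivAt 0 a).hasDerivAt.const_add _

lemma continuous_stdPhi : Continuous stdPhi :=
  continuous_iff_continuousAt.2 fun a => (hasDerivAt_stdPhi a).continuousAt

lemma strictMono_stdPhi : StrictMono stdPhi :=
  strictMono_of_deriv_pos fun a => by rw [(hasDerivAt_stdPhi a).deriv]; exact stdDensity_pos a

lemma stdPhi_zero : stdPhi 0 = 1 / 2 := by
  have := stdPhi_neg 0
  rw [neg_zero] at this
  linarith

/-- Linear growth of the normal distribution function near a point. -/
lemma exists_stdPhi_growth (a : ℝ) :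
    ∃ c : ℝ, 0 < c ∧ ∀ x, 0 ≤ x → x ≤ 1 → stdPhi a + c * x ≤ stdPhi (a + x) := by
  obtain ⟨t, -, ht⟩ := (isCompact_Icc (a := a) (b := a + 1)).exists_isMinOn
    ⟨a, by simp⟩ continuous_stdDensity.continuousOn
  refine ⟨stdDensity t, stdDensity_pos t, fun x hx hx1 => ?_⟩
  have := (convex_Icc a (a + 1)).mul_sub_le_image_sub_of_le_deriv (f := stdPhi)
    (C := stdDensity t) continuous_stdPhi.continuousOn
    (fun y _ => (hasDerivAt_stdPhi y).differentiableAt.differentiableWithinAt)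
    (fun y hy => by
      rw [(hasDerivAt_stdPhi y).deriv]; exact ht (interior_subset hy)) a (by simp)
    (a + x) ⟨by linarith, by linarith⟩ (by linarith)
  simp only [add_sub_cancel_left] at this
  linarith

/-- Mills' inequality. -/
lemma mul_one_sub_stdPhi_le {w : ℝ} (hw : 0 ≤ w) : w * (1 - stdPhi w) ≤ stdDensity w := by
  have hd : ∀ x ∈ Set.Ici w, HasDerivAt (fun t => -stdDensity t) (x * stdDensity x) x := by
    intro x _
    convert! (hasDerivAt_stdDensity x).neg using 1
    ring
  have hlim : Filter.Tendsto (fun t => -stdDensity t) Filter.atTop (nhds 0) := by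
    rw [← neg_zero]
    refine Filter.Tendsto.neg ?_
    have h2 : Filter.Tendsto (fun t : ℝ => -t ^ 2 / 2) Filter.atTop Filter.atBot := by
      have : Filter.Tendsto (fun t : ℝ => t ^ 2 / 2) Filter.atTop Filter.atTop :=
        (Filter.tendsto_pow_atTop (by norm_num)).atTop_div_const (by norm_num)
      refine (Filter.tendsto_neg_atTop_atBot.comp this).congr fun t => ?_
      simp; ring
    have := (Real.tendsto_exp_atBot.comp h2).div_const (Real.sqrt (2 * Real.pi))
    rw [zero_div] at this
    exact this
  have hnn : ∀ x ∈ Set.Ioi w, 0 ≤ x * stdDensity x := fun x hx =>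
    mul_nonneg (hw.trans (le_of_lt hx)) (stdDensity_pos x).le
  have hint_tail := MeasureTheory.integrableOn_Ioi_deriv_of_nonneg' hd hnn hlim
  have heq := MeasureTheory.integral_Ioi_of_hasDerivAt_of_nonneg' hd hnn hlim
  rw [one_sub_stdPhi, ← MeasureTheory.integral_const_mul]
  have : ∫ t in Set.Ioi w, w * stdDensity t ≤ ∫ t in Set.Ioi w, t * stdDensity t :=
    MeasureTheory.setIntegral_mono_on (integrable_stdDensity.integrableOn.const_mul w) hint_tail
      measurableSet_Ioi fun x hx => mul_le_mul_of_nonneg_right (le_of_lt hx) (stdDensity_pos x).le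
  simpa [heq] using this

/-- Solution of Stein's equation for the indicator of a half line. -/
noncomputable def steinSol (z w : ℝ) : ℝ :=
  stdPhi (min w z) * (1 - stdPhi (max w z)) / stdDensity w

lemma steinSol_nonneg (z w : ℝ) : 0 ≤ steinSol z w :=
  div_nonneg (mul_nonneg (stdPhi_nonneg _) (by linarith [stdPhi_le_one (max w z)]))
    (stdDensity_pos w).le

lemma continuous_steinSol (z : ℝ) : Continuous (steinSol z) := by
  unfold steinSol
  refine Continuous.div ?_ continuous_stdDensity fun w => (stdDensity_pos w).ne'
  exact (continuous_stdPhi.comp (by fun_prop)).mul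
    (continuous_const.sub (continuous_stdPhi.comp (by fun_prop)))

lemma abs_mul_steinSol_le (z w : ℝ) : |w| * steinSol z w ≤ 1 := by
  unfold steinSol
  rw [← mul_div_assoc, div_le_one (stdDensity_pos w)]
  have hmin := strictMono_stdPhi.monotone (min_le_left w z)
  have hmax := strictMono_stdPhi.monotone (le_max_left w z)
  have := stdPhi_nonneg (min w z)
  have := stdPhi_le_one (min w z)
  have := stdPhi_nonneg (max w z)
  have := stdPhi_le_one (max w z)
  rcases le_total 0 w with hw | hw
  · rw [abs_of_nonneg hw]
    refine le_trans (mul_le_mul_of_nonneg_left ?_ hw) (mul_one_sub_stdPhi_le hw)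
    nlinarith
  · rw [abs_of_nonpos hw]
    have h := mul_one_sub_stdPhi_le (w := -w) (by linarith)
    rw [stdPhi_neg, stdDensity_neg, sub_sub_cancel] at h
    refine le_trans (mul_le_mul_of_nonneg_left ?_ (by linarith)) h
    nlinarith

lemma steinSol_le (z w : ℝ) : steinSol z w ≤ 5 := by
  rcases le_total 1 |w| with hw | hw
  · have := abs_mul_steinSol_le z w
    nlinarith [steinSol_nonneg z w]
  · unfold steinSol
    rw [div_le_iff₀ (stdDensity_pos w)]
    have : 1 ≤ 5 * stdDensity w := by
      unfold stdDensity
      rw [← mul_div_assoc, le_div_iff₀ (by positivity), one_mul]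
      have h1 : Real.sqrt (2 * Real.pi) ≤ 5 / 2 + 1 / 10 :=
        Real.sqrt_le_iff.2 ⟨by norm_num, by linarith [Real.pi_lt_d2]⟩
      have h2 : Real.exp (-(1 / 2)) ≤ Real.exp (-w ^ 2 / 2) := by
        apply Real.exp_le_exp.2
        have := (sq_le_one_iff_abs_le_one w).2 hw
        linarith
      have h3 := Real.add_one_le_exp (-(1 / 2) : ℝ)
      have h4 : (13 / 25 : ℝ) ≤ Real.exp (-(1 / 2)) := by
        have h5 : Real.exp (-(1 / 2)) * Real.exp (-(1 / 2)) = (Real.exp 1)⁻¹ := by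
          rw [← Real.exp_add, ← Real.exp_neg]; norm_num
        have h6 : (1 / 2.7182818286 : ℝ) ≤ (Real.exp 1)⁻¹ := by
          rw [one_div]
          exact inv_anti₀ (Real.exp_pos 1) Real.exp_one_lt_d9.le
        nlinarith [Real.exp_pos (-(1 / 2))]
      linarith
    have := stdPhi_nonneg (min w z)
    have := stdPhi_le_one (min w z)
    have := stdPhi_nonneg (max w z)
    have := stdPhi_le_one (max w z)
    nlinarith

lemma hasDerivWithinAt_steinSol (z w : ℝ) :
    HasDerivWithinAt (steinSol z)
      (w * steinSol z w + (if w < z then 1 else 0) - stdPhi z) (Set.Ici w) w := by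
  have hw := (stdDensity_pos w).ne'
  by_cases h : w < z
  · have h1 : HasDerivAt (fun x => stdPhi x * (1 - stdPhi z) / stdDensity x)
        (w * steinSol z w + (if w < z then 1 else 0) - stdPhi z) w := by
      convert! ((hasDerivAt_stdPhi w).mul_const (1 - stdPhi z)).div (hasDerivAt_stdDensity w) hw
        using 1
      simp only [steinSol, h, if_true, min_eq_left h.le, max_eq_right h.le]
      field_simp
      ring
    refine (h1.congr_of_eventuallyEq ?_).hasDerivWithinAt
    filter_upwards [eventually_lt_nhds h] with x hx
    simp [steinSol, min_eq_left hx.le, max_eq_right hx.le]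
  · have h1 : HasDerivAt (fun x => stdPhi z * (1 - stdPhi x) / stdDensity x)
        (w * steinSol z w + (if w < z then 1 else 0) - stdPhi z) w := by
      convert! (((hasDerivAt_stdPhi w).const_sub 1).const_mul (stdPhi z)).div
        (hasDerivAt_stdDensity w) hw using 1
      simp only [steinSol, h, if_false, min_eq_right (not_lt.1 h), max_eq_left (not_lt.1 h)]
      field_simp
      ring
    refine h1.hasDerivWithinAt.congr (fun x hx => ?_) ?_
    · have : z ≤ x := (not_lt.1 h).trans hx
      simp [steinSol, min_eq_right this, max_eq_left this]
    · simp [steinSol, min_eq_right (not_lt.1 h), max_eq_left (not_lt.1 h)]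

lemma abs_steinSol_sub_le (z u v : ℝ) : |steinSol z u - steinSol z v| ≤ 2 * |u - v| := by
  wlog h : v ≤ u generalizing u v
  · rw [abs_sub_comm, abs_sub_comm u]
    exact this v u (le_of_not_ge h)
  have := norm_image_sub_le_of_norm_deriv_right_le_segment (f := steinSol z) (a := v) (b := u)
    (C := 2) (continuous_steinSol z).continuousOn (fun x _ => hasDerivWithinAt_steinSol z x)
    (fun x _ => by
      have h1 := abs_mul_steinSol_le z x
      rw [← abs_of_nonneg (steinSol_nonneg z x), ← abs_mul, abs_le] at h1
      have := stdPhi_nonneg z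
      have := stdPhi_le_one z
      rw [Real.norm_eq_abs, abs_le]
      split_ifs <;> constructor <;> linarith) u ⟨h, le_rfl⟩
  rwa [Real.norm_eq_abs, ← abs_of_nonneg (sub_nonneg.2 h)] at this

lemma mul_steinSol_sub_le (z u v : ℝ) :
    u * steinSol z u - v * steinSol z v ≤ (2 * |v| + 5) * |u - v| := by
  have h1 := abs_steinSol_sub_le z u v
  have h2 : u * steinSol z u - v * steinSol z v
      = (u - v) * steinSol z u + v * (steinSol z u - steinSol z v) := by ring
  rw [h2]
  have h3 : (u - v) * steinSol z u ≤ |u - v| * 5 :=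
    mul_le_mul (le_abs_self _) (steinSol_le z u) (steinSol_nonneg z u) (abs_nonneg _)
  have h4 : v * (steinSol z u - steinSol z v) ≤ |v| * (2 * |u - v|) :=
    (le_abs_self _).trans (by rw [abs_mul]; exact mul_le_mul_of_nonneg_left h1 (abs_nonneg v))
  linarith

/-- Upper bound on increments of the Stein solution near a reference point `w`. -/
lemma mul_steinSol_incr_le {z w v x d : ℝ} (h1 : |v - w| ≤ d) (h2 : |v + x - w| ≤ d) :
    x * (steinSol z (v + x) - steinSol z v) ≤
      x ^ 2 * (w * steinSol z w + (2 * |w| + 5) * d + (if w ≤ z + d then 1 else 0)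
        - stdPhi z) := by
  set M := w * steinSol z w + (2 * |w| + 5) * d + (if w ≤ z + d then 1 else 0) - stdPhi z with hM
  have main : ∀ a b, a ≤ b → w - d ≤ a → b ≤ w + d →
      steinSol z b - steinSol z a ≤ M * (b - a) := by
    intro a b hab ha hb
    have := image_le_of_deriv_right_le_deriv_boundary (f := steinSol z)
      (f' := fun x => x * steinSol z x + (if x < z then 1 else 0) - stdPhi z) (a := a) (b := b)
      (B := fun x => steinSol z a + M * (x - a)) (B' := fun _ => M)
      (continuous_steinSol z).continuousOn (fun x _ => hasDerivWithinAt_steinSol z x)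
      (by simp) (by fun_prop) (fun x _ => by
        have := (((hasDerivAt_id x).sub_const a).const_mul M).const_add (steinSol z a)
        simpa using this.hasDerivWithinAt)
      (fun x hx => by
        have h3 : |x - w| ≤ d := abs_le.2 ⟨by linarith [hx.1], by linarith [hx.2]⟩
        have h4 := mul_steinSol_sub_le z x w
        have h5 : (2 * |w| + 5) * |x - w| ≤ (2 * |w| + 5) * d :=
          mul_le_mul_of_nonneg_left h3 (by positivity)
        have h6 : (if x < z then (1 : ℝ) else 0) ≤ if w ≤ z + d then 1 else 0 := by
          split_ifs with h7 h8
          · exact le_rfl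
          · exact (h8 (by linarith [(abs_le.1 h3).1])).elim
          · norm_num
          · exact le_rfl
        rw [hM]
        linarith) (x := b) ⟨hab, le_rfl⟩
    linarith
  rw [abs_le] at h1 h2
  rcases le_total 0 x with hx | hx
  · have := main v (v + x) (by linarith) (by linarith) (by linarith)
    nlinarith
  · have := main (v + x) v (by linarith) (by linarith) (by linarith)
    nlinarith

/-- Product weight of a tuple. -/
noncomputable def prodWeight {ι Y : Type*} [Fintype ι] (p : ι → Y → ℝ) (ω : ι → Y) : ℝ :=
  ∏ i, p i (ω i)

section ProductWeights

variable {ι Y : Type*} [Fintype ι]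

lemma prodWeight_nonneg [Fintype Y] {p : ι → Y → ℝ} (hp : ∀ i, IsDist (p i)) (ω : ι → Y) :
    0 ≤ prodWeight p ω :=
  prod_nonneg fun i _ => (hp i).1 _

variable [DecidableEq ι]

lemma prodWeight_update (p : ι → Y → ℝ) (ω : ι → Y) (i : ι) (y : Y) :
    prodWeight p (Function.update ω i y) * p i (ω i) = prodWeight p ω * p i y := by
  unfold prodWeight
  rw [← mul_prod_erase univ _ (mem_univ i), ← mul_prod_erase univ (fun i => p i (ω i)) (mem_univ i)]
  have : ∏ x ∈ univ.erase i, p x (Function.update ω i y x) = ∏ x ∈ univ.erase i, p x (ω x) :=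
    prod_congr rfl fun x hx => by rw [Function.update_of_ne (ne_of_mem_erase hx)]
  rw [this, Function.update_self]
  ring

lemma sum_update_eq (ξ : ι → Y → ℝ) (ω : ι → Y) (i : ι) (y : Y) :
    ∑ k, ξ k (Function.update ω i y k) = ∑ k, ξ k (ω k) - ξ i (ω i) + ξ i y := by
  rw [← add_sum_erase univ _ (mem_univ i), ← add_sum_erase univ (fun k => ξ k (ω k)) (mem_univ i)]
  have : ∑ x ∈ univ.erase i, ξ x (Function.update ω i y x) = ∑ x ∈ univ.erase i, ξ x (ω x) :=
    sum_congr rfl fun x hx => by rw [Function.update_of_ne (ne_of_mem_erase hx)]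
  rw [this, Function.update_self]
  ring

variable [Fintype Y]

lemma sum_prodWeight {p : ι → Y → ℝ} (hp : ∀ i, IsDist (p i)) :
    ∑ ω, prodWeight p ω = 1 := by
  have := Finset.prod_univ_sum (fun _ : ι => (univ : Finset Y)) p
  rw [Fintype.piFinset_univ] at this
  unfold prodWeight
  rw [← this]
  exact prod_eq_one fun i _ => (hp i).2

/-- Exchanging a coordinate with an independent copy. -/
lemma sum_prodWeight_swap (p : ι → Y → ℝ) (i : ι) (G : (ι → Y) → Y → ℝ) :
    ∑ ω, ∑ y, prodWeight p ω * p i y * G (Function.update ω i y) (ω i) =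
      ∑ ω, ∑ y, prodWeight p ω * p i y * G ω y := by
  rw [← Fintype.sum_prod_type', ← Fintype.sum_prod_type']
  have hinv : Function.Involutive
      (fun z : (ι → Y) × Y => (Function.update z.1 i z.2, z.1 i)) := fun z => by simp
  refine Fintype.sum_equiv hinv.toPerm _ _ fun z => ?_
  simp only [Function.Involutive.coe_toPerm]
  rw [prodWeight_update]

lemma sum_prodWeight_resample {p : ι → Y → ℝ} (hp : ∀ i, IsDist (p i)) (i : ι)
    (g : Y → ℝ) (G : (ι → Y) → ℝ) :
    ∑ ω, prodWeight p ω * (g (ω i) * G ω) =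
      ∑ ω, ∑ y, prodWeight p ω * p i y * (g y * G (Function.update ω i y)) := by
  have := sum_prodWeight_swap p i (fun ω y => g (ω i) * G ω)
  simp only [Function.update_self] at this
  rw [this]
  refine sum_congr rfl fun ω _ => ?_
  rw [← sum_mul, ← mul_sum, (hp i).2, mul_one]

lemma sum_prodWeight_sq {p : ι → Y → ℝ} (hp : ∀ i, IsDist (p i)) {ξ : ι → Y → ℝ}
    (hξ : ∀ i, ∑ y, p i y * ξ i y = 0) :
    ∑ ω, prodWeight p ω * (∑ i, ξ i (ω i)) ^ 2 = ∑ i, ∑ y, p i y * ξ i y ^ 2 := by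
  have h1 : ∀ ω, prodWeight p ω * (∑ i, ξ i (ω i)) ^ 2 =
      ∑ i, prodWeight p ω * (ξ i (ω i) * ∑ k, ξ k (ω k)) := by
    intro ω
    rw [← mul_sum, ← sum_mul, sq]
  simp_rw [h1]
  rw [sum_comm]
  refine sum_congr rfl fun i _ => ?_
  rw [sum_prodWeight_resample hp i (ξ i) fun ω => ∑ k, ξ k (ω k)]
  have h2 : ∀ ω, ∑ y, prodWeight p ω * p i y * (ξ i y * ∑ k, ξ k (Function.update ω i y k)) =
      prodWeight p ω * ∑ y, p i y * ξ i y ^ 2 := by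
    intro ω
    have : ∀ y, prodWeight p ω * p i y * (ξ i y * ∑ k, ξ k (Function.update ω i y k)) =
        prodWeight p ω * (∑ k, ξ k (ω k) - ξ i (ω i)) * (p i y * ξ i y) +
          prodWeight p ω * (p i y * ξ i y ^ 2) := by
      intro y
      rw [sum_update_eq]; ring
    simp_rw [this]
    rw [sum_add_distrib, ← mul_sum, ← mul_sum, hξ i]
    ring
  simp_rw [h2]
  rw [← sum_mul, sum_prodWeight hp, one_mul]

/-- One-sided Chebyshev-type bound for sums of independent variables. -/
lemma one_sub_le_sum_prodWeight {p : ι → Y → ℝ} (hp : ∀ i, IsDist (p i)) {ξ : ι → Y → ℝ}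
    (hξ : ∀ i, ∑ y, p i y * ξ i y = 0) {t : ℝ} (ht : 0 < t) :
    1 - (∑ i, ∑ y, p i y * ξ i y ^ 2) / t ^ 2 ≤
      ∑ ω, prodWeight p ω * (if ∑ i, ξ i (ω i) ≤ t then 1 else 0) := by
  rw [← sum_prodWeight_sq hp hξ, sum_div]
  calc _ = ∑ ω, (prodWeight p ω - prodWeight p ω * (∑ i, ξ i (ω i)) ^ 2 / t ^ 2) := by
        rw [sum_sub_distrib, sum_prodWeight hp]
    _ ≤ _ := ?_
  refine sum_le_sum fun ω _ => ?_
  have h0 := prodWeight_nonneg hp ω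
  rw [mul_div_assoc]
  split_ifs with h
  · have : 0 ≤ prodWeight p ω * ((∑ i, ξ i (ω i)) ^ 2 / t ^ 2) := by positivity
    linarith
  · have : 1 ≤ (∑ i, ξ i (ω i)) ^ 2 / t ^ 2 := by
      rw [one_le_div (by positivity)]
      nlinarith [not_le.1 h]
    nlinarith

/-- One-sided Berry–Esseen bound for sums of independent uniformly bounded variables. -/
lemma stdPhi_sub_le_sum_prodWeight {p : ι → Y → ℝ} (hp : ∀ i, IsDist (p i)) {ξ : ι → Y → ℝ}
    (hξ : ∀ i, ∑ y, p i y * ξ i y = 0) {d : ℝ} (hd : ∀ i y, |ξ i y| ≤ d) (hd0 : 0 ≤ d)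
    (hvar : ∑ i, ∑ y, p i y * ξ i y ^ 2 = 1) (z : ℝ) :
    stdPhi z - 14 * d ≤
      ∑ ω, prodWeight p ω * (if ∑ i, ξ i (ω i) ≤ z + 2 * d then 1 else 0) := by
  set S : (ι → Y) → ℝ := fun ω => ∑ i, ξ i (ω i) with hS
  set f := steinSol z
  have hSsq : ∑ ω, prodWeight p ω * S ω ^ 2 = 1 := by
    rw [← hvar]; exact sum_prodWeight_sq hp hξ
  have h1 : ∑ ω, prodWeight p ω * (S ω * f (S ω)) =
      ∑ i, ∑ ω, ∑ y, prodWeight p ω * p i y *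
        (ξ i y * (f (S ω - ξ i (ω i) + ξ i y) - f (S ω - ξ i (ω i)))) := by
    have h2 : ∀ ω, prodWeight p ω * (S ω * f (S ω)) =
        ∑ i, prodWeight p ω * (ξ i (ω i) * f (S ω)) := by
      intro ω
      rw [← mul_sum, ← sum_mul]
    simp_rw [h2]
    rw [sum_comm]
    refine sum_congr rfl fun i _ => ?_
    rw [sum_prodWeight_resample hp i (ξ i) fun ω => f (S ω)]
    refine sum_congr rfl fun ω _ => ?_
    simp only [hS, sum_update_eq]
    have h3 : ∑ y, prodWeight p ω * p i y * (ξ i y * f (S ω - ξ i (ω i))) = 0 := by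
      have : ∀ y, prodWeight p ω * p i y * (ξ i y * f (S ω - ξ i (ω i))) =
          prodWeight p ω * f (S ω - ξ i (ω i)) * (p i y * ξ i y) := fun y => by ring
      simp_rw [this]
      rw [← mul_sum, hξ i, mul_zero]
    rw [← sub_zero (∑ y, _), ← h3, ← sum_sub_distrib]
    exact sum_congr rfl fun y _ => by ring
  set K : (ι → Y) → ℝ := fun ω => S ω * f (S ω) + (2 * |S ω| + 5) * (2 * d) +
    (if S ω ≤ z + 2 * d then 1 else 0) - stdPhi z with hK
  have h4 : ∑ ω, prodWeight p ω * (S ω * f (S ω)) ≤ ∑ ω, prodWeight p ω * K ω := by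
    have h5 : ∑ ω, prodWeight p ω * K ω =
        ∑ i, ∑ ω, ∑ y, prodWeight p ω * p i y * (ξ i y ^ 2 * K ω) := by
      have : ∀ i, ∑ ω, ∑ y, prodWeight p ω * p i y * (ξ i y ^ 2 * K ω) =
          (∑ y, p i y * ξ i y ^ 2) * ∑ ω, prodWeight p ω * K ω := by
        intro i
        rw [mul_sum]
        refine sum_congr rfl fun ω _ => ?_
        rw [sum_mul]
        exact sum_congr rfl fun y _ => by ring
      simp_rw [this]
      rw [← sum_mul, hvar, one_mul]
    rw [h1, h5]
    refine sum_le_sum fun i _ => sum_le_sum fun ω _ => sum_le_sum fun y _ => ?_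
    refine mul_le_mul_of_nonneg_left ?_ (mul_nonneg (prodWeight_nonneg hp ω) ((hp i).1 y))
    have e1 := abs_le.1 (hd i (ω i))
    have e2 := abs_le.1 (hd i y)
    exact mul_steinSol_incr_le (abs_le.2 ⟨by linarith, by linarith⟩)
      (abs_le.2 ⟨by linarith, by linarith⟩)
  have h6 : ∑ ω, prodWeight p ω * K ω ≤ ∑ ω, prodWeight p ω * (S ω * f (S ω)) +
      ∑ ω, prodWeight p ω * (S ω ^ 2) * (2 * d) + ∑ ω, prodWeight p ω * (12 * d - stdPhi z) +
      ∑ ω, prodWeight p ω * (if S ω ≤ z + 2 * d then 1 else 0) := by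
    rw [← sum_add_distrib, ← sum_add_distrib, ← sum_add_distrib]
    refine sum_le_sum fun ω _ => ?_
    have : 2 * |S ω| ≤ S ω ^ 2 + 1 := by
      rw [← sq_abs]; nlinarith [sq_nonneg (|S ω| - 1)]
    have h7 : K ω ≤ S ω * f (S ω) + S ω ^ 2 * (2 * d) + (12 * d - stdPhi z) +
        (if S ω ≤ z + 2 * d then 1 else 0) := by
      rw [hK]; nlinarith
    calc _ ≤ _ := mul_le_mul_of_nonneg_left h7 (prodWeight_nonneg hp ω)
      _ = _ := by ring
  rw [← sum_mul, ← sum_mul, hSsq, sum_prodWeight hp] at h6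
  linarith

end ProductWeights

/-- Quantiles of sums of independent, uniformly bounded, centred variables: up to an additive
constant they are at most the Gaussian ones. -/
lemma exists_quantile_shift {Y : Type*} [Fintype Y] {α a B : ℝ} (ha : stdPhi a = α)
    (hα : α < 1) (hB : 0 < B) :
    ∃ F : ℝ, 0 < F ∧ ∃ n₀ : ℕ, ∀ n, n₀ ≤ n → ∀ p ξ : Fin n → Y → ℝ, (∀ i, IsDist (p i)) →
      (∀ i, ∑ y, p i y * ξ i y = 0) → (∀ i y, |ξ i y| ≤ B) →
      α + 1 / Real.sqrt n < ∑ ω, prodWeight p ω *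
        (if ∑ i, ξ i (ω i) ≤ Real.sqrt (∑ i, ∑ y, p i y * ξ i y ^ 2) * a + F then 1 else 0) := by
  obtain ⟨c, hc, hgrow⟩ := exists_stdPhi_growth a
  set x := 16 * B / c with hx
  have hx0 : 0 < x := by positivity
  have h1α : 0 < 1 - α := by linarith
  set T := 2 * x / (1 - α) with hT
  have hT0 : 0 < T := by positivity
  refine ⟨x + 2 * B + T + x * |a|, by positivity, ⌈4 / (1 - α) ^ 2⌉₊ + 1,
    fun n hn p ξ hp hξ hξB => ?_⟩
  set v := ∑ i, ∑ y, p i y * ξ i y ^ 2 with hv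
  have hv0 : 0 ≤ v := sum_nonneg fun i _ => sum_nonneg fun y _ =>
    mul_nonneg ((hp i).1 y) (sq_nonneg _)
  have hn1 : (1 : ℝ) ≤ n := by exact_mod_cast (Nat.le_add_left 1 _).trans hn
  have hn2 : 4 / (1 - α) ^ 2 ≤ (n : ℝ) := (Nat.le_ceil _).trans (by
    exact_mod_cast (Nat.le_add_right _ 1).trans hn)
  have hsn : 0 < Real.sqrt n := Real.sqrt_pos.2 (by linarith)
  have hmono : ∀ t t' : ℝ, t ≤ t' →
      ∑ ω, prodWeight p ω * (if ∑ i, ξ i (ω i) ≤ t then (1 : ℝ) else 0) ≤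
      ∑ ω, prodWeight p ω * (if ∑ i, ξ i (ω i) ≤ t' then (1 : ℝ) else 0) := by
    intro t t' htt
    refine sum_le_sum fun ω _ => mul_le_mul_of_nonneg_left ?_ (prodWeight_nonneg hp ω)
    split_ifs with h1 h2
    · exact le_rfl
    · exact (h2 (h1.trans htt)).elim
    · norm_num
    · exact le_rfl
  set σ := Real.sqrt v with hσ
  have hσ0 : 0 ≤ σ := Real.sqrt_nonneg v
  have hσsq : σ ^ 2 = v := Real.sq_sqrt hv0
  rcases le_total x σ with hxσ | hxσ
  · have hσp : 0 < σ := hx0.trans_le hxσ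
    have hσn : σ ≤ B * Real.sqrt n := by
      rw [hσ, Real.sqrt_le_left (by positivity), mul_pow, Real.sq_sqrt (by linarith)]
      have : ∀ i, ∑ y, p i y * ξ i y ^ 2 ≤ B ^ 2 := by
        intro i
        calc ∑ y, p i y * ξ i y ^ 2 ≤ ∑ y, p i y * B ^ 2 :=
              sum_le_sum fun y _ => mul_le_mul_of_nonneg_left
                (sq_le_sq' (abs_le.1 (hξB i y)).1 (abs_le.1 (hξB i y)).2) ((hp i).1 y)
          _ = B ^ 2 := by rw [← sum_mul, (hp i).2, one_mul]
      calc v ≤ ∑ _i : Fin n, B ^ 2 := sum_le_sum fun i _ => this i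
        _ = B ^ 2 * n := by simp [mul_comm]
    have hBE := stdPhi_sub_le_sum_prodWeight hp (ξ := fun i y => ξ i y / σ) (d := B / σ)
      (fun i => by simp_rw [← mul_div_assoc]; rw [← sum_div, hξ i, zero_div])
      (fun i y => by
        rw [abs_div, abs_of_pos hσp]
        exact div_le_div_of_nonneg_right (hξB i y) hσp.le)
      (by positivity)
      (by
        simp_rw [div_pow, ← mul_div_assoc, ← sum_div]
        rw [hσsq]
        exact div_self (by change v ≠ 0; rw [← hσsq]; positivity)) (a + x / σ)
    have hg := hgrow (x / σ) (by positivity) (div_le_one_of_le₀ hxσ hσ0)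
    have hcx : c * (x / σ) = 16 * (B / σ) := by rw [hx]; field_simp
    have h1n : 1 / Real.sqrt n ≤ B / σ := by
      rw [div_le_div_iff₀ hsn hσp]; linarith
    have hBσ : 0 < B / σ := by positivity
    have hev : ∀ ω : Fin n → Y, (∑ i, ξ i (ω i) / σ ≤ a + x / σ + 2 * (B / σ)) ↔
        ∑ i, ξ i (ω i) ≤ σ * a + x + 2 * B := by
      intro ω
      rw [← sum_div, div_le_iff₀ hσp]
      have : (a + x / σ + 2 * (B / σ)) * σ = σ * a + x + 2 * B := by field_simp
      rw [this]
    simp_rw [hev] at hBE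
    refine lt_of_lt_of_le ?_ (hBE.trans (hmono _ _ ?_))
    · rw [ha, hcx] at hg
      linarith
    · have : 0 ≤ x * |a| := by positivity
      linarith
  · have hch := one_sub_le_sum_prodWeight hp hξ hT0
    refine lt_of_lt_of_le ?_ (hch.trans (hmono _ _ ?_))
    · rw [← hv, ← hσsq]
      have h2 : σ ^ 2 / T ^ 2 ≤ (1 - α) ^ 2 / 4 := by
        rw [hT, div_pow, mul_pow, div_div_eq_mul_div, div_le_div_iff₀ (by positivity) (by norm_num)]
        have : σ ^ 2 ≤ x ^ 2 := by gcongr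
        nlinarith [sq_nonneg (1 - α)]
      have h3 : 1 / Real.sqrt n ≤ (1 - α) / 2 := by
        rw [div_le_iff₀ hsn]
        have : 2 / (1 - α) ≤ Real.sqrt n := by
          apply Real.le_sqrt_of_sq_le
          rw [div_pow]; norm_num; exact hn2
        rw [div_le_iff₀ h1α] at this
        linarith
      have hα0 : 0 ≤ α := ha ▸ stdPhi_nonneg a
      nlinarith
    · have : -(x * |a|) ≤ σ * a := by
        have h1 : σ * |a| ≤ x * |a| := mul_le_mul_of_nonneg_right hxσ (abs_nonneg a)
        have h2 := neg_abs_le a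
        nlinarith
      linarith

section Channel

variable {𝒳 𝒴 : Type*} [Fintype 𝒳] [Fintype 𝒴] {W : 𝒳 → 𝒴 → ℝ}

lemma IsChannel.isDist (hW : IsChannel W) (x : 𝒳) : IsDist (W x) :=
  ⟨hW.1 x, hW.2 x⟩

lemma IsDist.le_one {Z : Type*} [Fintype Z] {p : Z → ℝ} (hp : IsDist p) (z : Z) : p z ≤ 1 := by
  rw [← hp.2]
  exact single_le_sum (fun i _ => hp.1 i) (mem_univ z)

lemma isDist_outDist {P : 𝒳 → ℝ} (hP : IsDist P) (hW : IsChannel W) : IsDist (outDist P W) := by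
  refine ⟨fun y => sum_nonneg fun x _ => mul_nonneg (hP.1 x) (hW.1 x y), ?_⟩
  unfold outDist
  rw [sum_comm]
  simp_rw [← mul_sum, hW.2, mul_one]
  exact hP.2

lemma mutInfo_eq_sum_divX (P : 𝒳 → ℝ) (W : 𝒳 → 𝒴 → ℝ) :
    mutInfo P W = ∑ x, P x * divX W (outDist P W) x := by
  unfold mutInfo divX
  simp_rw [mul_sum, mul_assoc]

lemma bddAbove_mutInfo (hW : IsChannel W) :
    BddAbove {c : ℝ | ∃ P : 𝒳 → ℝ, IsDist P ∧ c = mutInfo P W} := by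
  refine ⟨∑ x : 𝒳, ∑ y, W x y, ?_⟩
  rintro _ ⟨P, hP, rfl⟩
  refine sum_le_sum fun x _ => sum_le_sum fun y _ => ?_
  have h0 := (isDist_outDist hP hW).1 y
  have hle : P x * W x y ≤ outDist P W y :=
    single_le_sum (f := fun x => P x * W x y)
      (fun i _ => mul_nonneg (hP.1 i) (hW.1 i y)) (mem_univ x)
  calc P x * W x y * Real.log (W x y / outDist P W y)
      ≤ P x * W x y * (W x y / outDist P W y) :=
        mul_le_mul_of_nonneg_left (Real.log_le_self (div_nonneg (hW.1 x y) h0))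
          (mul_nonneg (hP.1 x) (hW.1 x y))
    _ = W x y * (P x * W x y / outDist P W y) := by ring
    _ ≤ W x y * 1 := mul_le_mul_of_nonneg_left (div_le_one_of_le₀ hle h0) (hW.1 x y)
    _ = W x y := mul_one _

lemma mutInfo_le_capacity (hW : IsChannel W) {P : 𝒳 → ℝ} (hP : IsDist P) :
    mutInfo P W ≤ capacity W :=
  le_csSup (bddAbove_mutInfo hW) ⟨P, hP, rfl⟩

/-- Replacing the true output distribution by another one does not decrease the divergence. -/
lemma mutInfo_le_sum_divX (hW : IsChannel W) {P : 𝒳 → ℝ} (hP : IsDist P) {Q : 𝒴 → ℝ}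
    (hQ : IsDist Q) (hac : ∀ x y, 0 < P x → 0 < W x y → 0 < Q y) :
    mutInfo P W ≤ ∑ x, P x * divX W Q x := by
  rw [mutInfo_eq_sum_divX]
  have hO := isDist_outDist hP hW
  have key : ∀ x y, P x * (W x y * Real.log (W x y / outDist P W y)) +
      P x * W x y * (1 - Q y / outDist P W y) ≤ P x * (W x y * Real.log (W x y / Q y)) := by
    intro x y
    rcases (hP.1 x).eq_or_lt with h | hPx
    · simp [← h]
    rcases (hW.1 x y).eq_or_lt with h | hWx
    · simp [← h]
    have hQy := hac x y hPx hWx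
    have hOy : 0 < outDist P W y := lt_of_lt_of_le (mul_pos hPx hWx)
      (single_le_sum (f := fun x => P x * W x y)
        (fun i _ => mul_nonneg (hP.1 i) (hW.1 i y)) (mem_univ x))
    have h1 := Real.log_le_sub_one_of_pos (div_pos hQy hOy)
    rw [Real.log_div hQy.ne' hOy.ne'] at h1
    rw [Real.log_div hWx.ne' hQy.ne', Real.log_div hWx.ne' hOy.ne']
    have := mul_le_mul_of_nonneg_left h1 (mul_pos hPx hWx).le
    nlinarith
  have h2 : 0 ≤ ∑ x, ∑ y, P x * W x y * (1 - Q y / outDist P W y) := by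
    rw [sum_comm]
    simp_rw [← sum_mul]
    change 0 ≤ ∑ y, outDist P W y * (1 - Q y / outDist P W y)
    have : ∑ y, (outDist P W y - Q y) = 0 := by rw [sum_sub_distrib, hO.2, hQ.2, sub_self]
    rw [← this]
    refine sum_le_sum fun y _ => ?_
    rcases (hO.1 y).eq_or_lt with h | h
    · rw [← h]; have := hQ.1 y; simpa using this
    · rw [mul_sub, mul_div_cancel₀ _ h.ne', mul_one]
  have h3 := sum_le_sum fun x (_ : x ∈ univ) => sum_le_sum fun y (_ : y ∈ univ) => key x y
  simp_rw [sum_add_distrib] at h3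
  simp only [divX, mul_sum]
  linarith

lemma divX_mix_le (hW : IsChannel W) {P : 𝒳 → ℝ} (hP : CapacityAchieving P W) (x₀ : 𝒳) {t : ℝ}
    (ht0 : 0 < t) (ht1 : t < 1) :
    divX W (fun y => (1 - t) * outDist P W y + t * W x₀ y) x₀ ≤ capacity W := by
  classical
  obtain ⟨hPd, hPc⟩ := hP
  set P' : 𝒳 → ℝ := fun x => (1 - t) * P x + t * (if x = x₀ then 1 else 0) with hP'
  have hP'd : IsDist P' := by
    refine ⟨fun x => ?_, ?_⟩
    · have := mul_nonneg (by linarith : 0 ≤ 1 - t) (hPd.1 x)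
      simp only [hP']; split_ifs <;> linarith
    · simp only [hP', sum_add_distrib, ← mul_sum, hPd.2]; simp
  have hout : outDist P' W = fun y => (1 - t) * outDist P W y + t * W x₀ y := by
    ext y
    simp [outDist, hP', add_mul, sum_add_distrib, mul_sum, mul_assoc]
  have h1 := mutInfo_le_capacity hW hP'd
  have h2 := mutInfo_le_sum_divX hW hPd (isDist_outDist hP'd hW) (fun x y hx hy => by
    refine lt_of_lt_of_le (mul_pos ?_ hy) (single_le_sum (f := fun x => P' x * W x y)
        (fun i _ => mul_nonneg (hP'd.1 i) (hW.1 i y)) (mem_univ x))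
    have := mul_pos (by linarith : 0 < 1 - t) hx
    simp only [hP']; split_ifs <;> linarith)
  rw [mutInfo_eq_sum_divX] at h1
  rw [hPc] at h2
  have h3 : ∑ x, P' x * divX W (outDist P' W) x =
      (1 - t) * ∑ x, P x * divX W (outDist P' W) x + t * divX W (outDist P' W) x₀ := by
    simp only [hP', add_mul, sum_add_distrib, mul_sum, mul_assoc]
    simp
  rw [h3] at h1
  rw [← hout]
  have h4 := mul_le_mul_of_nonneg_left h2 (by linarith : 0 ≤ 1 - t)
  have h5 : t * divX W (outDist P' W) x₀ ≤ t * capacity W := by linarith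
  exact le_of_mul_le_mul_left h5 ht0

lemma outDist_pos_of_capacityAchieving (hW : IsChannel W) {P : 𝒳 → ℝ}
    (hP : CapacityAchieving P W) {x₀ : 𝒳} {y₀ : 𝒴} (h : 0 < W x₀ y₀) : 0 < outDist P W y₀ := by
  classical
  have hQ := isDist_outDist hP.1 hW
  by_contra hneg
  have hQ0 : outDist P W y₀ = 0 := le_antisymm (not_lt.1 hneg) (hQ.1 y₀)
  set t := Real.exp (-((|capacity W| + 2) / W x₀ y₀)) with ht
  have ht0 : 0 < t := Real.exp_pos _
  have ht1 : t < 1 := by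
    rw [ht, Real.exp_lt_one_iff, neg_lt_zero]; positivity
  have h1 := divX_mix_le hW hP x₀ ht0 ht1
  set Q : 𝒴 → ℝ := fun y => (1 - t) * outDist P W y + t * W x₀ y with hQt
  have hQn : ∀ y, 0 ≤ Q y := fun y =>
    add_nonneg (mul_nonneg (by linarith) (hQ.1 y)) (mul_nonneg ht0.le (hW.1 _ _))
  have hQs : ∑ y, Q y = 1 := by
    simp only [hQt, sum_add_distrib, ← mul_sum, hQ.2, hW.2]; ring
  have h2 : ∀ y, -Q y ≤ W x₀ y * Real.log (W x₀ y / Q y) := by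
    intro y
    rcases (hW.1 x₀ y).eq_or_lt with h | hw
    · simp [← h, hQn]
    have hq : 0 < Q y := lt_of_lt_of_le (mul_pos ht0 hw)
      (le_add_of_nonneg_left (mul_nonneg (by linarith) (hQ.1 y)))
    have h3 := Real.log_le_sub_one_of_pos (div_pos hq hw)
    rw [Real.log_div hq.ne' hw.ne'] at h3
    rw [Real.log_div hw.ne' hq.ne']
    have h4 := mul_le_mul_of_nonneg_left h3 hw.le
    have h5 : W x₀ y * (Q y / W x₀ y) = Q y := mul_div_cancel₀ _ hw.ne'
    nlinarith
  have h3 : W x₀ y₀ * Real.log (W x₀ y₀ / Q y₀) = |capacity W| + 2 := by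
    have : W x₀ y₀ / Q y₀ = t⁻¹ := by
      simp only [hQt, hQ0]; field_simp; ring
    rw [this, Real.log_inv, ht, Real.log_exp, neg_neg, mul_div_cancel₀ _ h.ne']
  have h4 : -1 + (|capacity W| + 2) ≤ divX W Q x₀ := by
    unfold divX
    rw [← add_sum_erase univ _ (mem_univ y₀), h3]
    have h5 : ∑ y ∈ univ.erase y₀, -Q y ≤
        ∑ y ∈ univ.erase y₀, W x₀ y * Real.log (W x₀ y / Q y) := sum_le_sum fun y _ => h2 y
    have h6 : ∑ y ∈ univ.erase y₀, Q y ≤ 1 := by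
      rw [← hQs]
      exact sum_le_sum_of_subset_of_nonneg (erase_subset _ _) fun y _ _ => hQn y
    rw [sum_neg_distrib] at h5
    linarith
  linarith [le_abs_self (capacity W)]

/-- Kuhn–Tucker condition for capacity-achieving input distributions. -/
lemma divX_le_capacity (hW : IsChannel W) {P : 𝒳 → ℝ} (hP : CapacityAchieving P W) (x : 𝒳) :
    divX W (outDist P W) x ≤ capacity W := by
  have hlim : Filter.Tendsto
      (fun t : ℝ => divX W (fun y => (1 - t) * outDist P W y + t * W x y) x)
      (nhdsWithin 0 (Set.Ioi 0)) (nhds (divX W (outDist P W) x)) := by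
    refine tendsto_nhdsWithin_of_tendsto_nhds ?_
    unfold divX
    refine tendsto_finsetSum _ fun y _ => ?_
    rcases (hW.1 x y).eq_or_lt with h | h
    · simp [← h]
    · have hq := outDist_pos_of_capacityAchieving hW hP h
      have hc : ContinuousAt (fun t : ℝ => W x y *
          Real.log (W x y / ((1 - t) * outDist P W y + t * W x y))) 0 := by
        refine continuousAt_const.mul (ContinuousAt.log ?_ ?_)
        · refine continuousAt_const.div (by fun_prop) ?_
          simpa using hq.ne'
        · simpa using ⟨h.ne', hq.ne'⟩
      simpa using hc.tendsto
  refine le_of_tendsto hlim ?_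
  filter_upwards [Ioo_mem_nhdsGT (show (0 : ℝ) < 1 by norm_num)] with t ht
  exact divX_mix_le hW hP x ht.1 ht.2

/-- An input distribution with the capacity-achieving output and support on inputs of maximal
divergence achieves capacity. -/
lemma capacityAchieving_of_outDist_eq {P : 𝒳 → ℝ} (hPd : IsDist P) {Q : 𝒴 → ℝ}
    (hPQ : outDist P W = Q) (hC : ∑ x, P x * (capacity W - divX W Q x) = 0) :
    CapacityAchieving P W := by
  refine ⟨hPd, ?_⟩
  simp_rw [mul_sub] at hC
  rw [sum_sub_distrib, ← sum_mul, hPd.2, one_mul] at hC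
  rw [mutInfo_eq_sum_divX, hPQ]
  linarith

/-- A function of the input whose mean is nonpositive under all capacity-achieving inputs is
bounded above linearly in the deviation from optimality. -/
lemma exists_sum_le_of_optimal {Q : 𝒴 → ℝ} (b : 𝒳 → ℝ)
    (hdiv : ∀ x, divX W Q x ≤ capacity W)
    (hb : ∀ P, CapacityAchieving P W → outDist P W = Q → ∑ x, P x * b x ≤ 0) :
    ∃ L : ℝ, 0 ≤ L ∧ ∀ (n : ℕ) (xs : Fin n → 𝒳) (R : ℝ),
      (∀ y, |∑ k, (W (xs k) y - Q y)| ≤ R) → 0 ≤ R →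
      ∑ k, b (xs k) ≤ L * (R + ∑ k, (capacity W - divX W Q (xs k))) := by
  obtain ⟨l, hl⟩ := exists_multipliers (ι := 𝒳) (κ := Option 𝒴)
    (fun x o => o.elim (capacity W - divX W Q x) fun y => W x y - Q y) b (by
      intro p hp hpa
      have hp1 : ∑ x, p x * (capacity W - divX W Q x) = 0 := hpa none
      have hp2 : ∀ y, ∑ x, p x * (W x y - Q y) = 0 := fun y => hpa (some y)
      rcases (sum_nonneg fun x (_ : x ∈ univ) => hp x).eq_or_lt with h0 | hs
      · have := (sum_eq_zero_iff_of_nonneg fun x (_ : x ∈ univ) => hp x).1 h0.symm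
        exact (sum_eq_zero fun x hx => by rw [this x hx, zero_mul]).le
      · set s := ∑ x, p x
        have hd : IsDist fun x => p x / s := by
          refine ⟨fun x => div_nonneg (hp x) hs.le, ?_⟩
          rw [← sum_div]; exact div_self hs.ne'
        have hout : outDist (fun x => p x / s) W = Q := by
          ext y
          have := hp2 y
          simp_rw [mul_sub] at this
          rw [sum_sub_distrib, ← sum_mul] at this
          simp only [outDist, div_mul_eq_mul_div]
          rw [← sum_div, div_eq_iff hs.ne']
          linarith
        have hca := capacityAchieving_of_outDist_eq hd hout (by
          simp only [div_mul_eq_mul_div]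
          rw [← sum_div, hp1, zero_div])
        have := hb _ hca hout
        simp only [div_mul_eq_mul_div] at this
        rw [← sum_div, div_le_iff₀ hs, zero_mul] at this
        exact this)
  simp only [Fintype.sum_option, Option.elim] at hl
  refine ⟨|l none| + ∑ y, |l (some y)|, by positivity, fun n xs R hR hR0 => ?_⟩
  have hG : 0 ≤ ∑ k, (capacity W - divX W Q (xs k)) :=
    sum_nonneg fun k _ => sub_nonneg.2 (hdiv _)
  have h1 : ∑ k, b (xs k) ≤ l none * ∑ k, (capacity W - divX W Q (xs k)) +
      ∑ y, l (some y) * ∑ k, (W (xs k) y - Q y) := by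
    refine (sum_le_sum fun k _ => hl (xs k)).trans (le_of_eq ?_)
    rw [sum_add_distrib, sum_comm]
    simp_rw [mul_sum]
  have h2 : ∑ y, l (some y) * ∑ k, (W (xs k) y - Q y) ≤ ∑ y, |l (some y)| * R :=
    sum_le_sum fun y _ => (le_abs_self _).trans (by
      rw [abs_mul]; exact mul_le_mul_of_nonneg_left (hR y) (abs_nonneg _))
  have h3 := mul_le_mul_of_nonneg_right (le_abs_self (l none)) hG
  rw [← sum_mul] at h2
  have h4 : 0 ≤ |l none| * R := by positivity
  have h5 : 0 ≤ (∑ y, |l (some y)|) * ∑ k, (capacity W - divX W Q (xs k)) := by positivity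
  linarith

/-- Variance of the information density at the input `x`. -/
noncomputable def inputInfoVar (W : 𝒳 → 𝒴 → ℝ) (Q : 𝒴 → ℝ) (x : 𝒳) : ℝ :=
  ∑ y, W x y * (Real.log (W x y / Q y) - divX W Q x) ^ 2

lemma exists_sum_inputInfoVar_le_Vmax {Q : 𝒴 → ℝ} (hdiv : ∀ x, divX W Q x ≤ capacity W)
    (hV : 0 < Vmax W) :
    ∃ L : ℝ, 0 ≤ L ∧ ∀ (n : ℕ) (xs : Fin n → 𝒳) (R : ℝ),
      (∀ y, |∑ k, (W (xs k) y - Q y)| ≤ R) → 0 ≤ R →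
      ∑ k, inputInfoVar W Q (xs k) ≤
        n * Vmax W + L * (R + ∑ k, (capacity W - divX W Q (xs k))) := by
  have hbdd : BddAbove {v : ℝ | ∃ P : 𝒳 → ℝ, CapacityAchieving P W ∧
      v = condInfoVar W (outDist P W) P} := by
    by_contra h
    rw [Vmax, Real.sSup_of_not_bddAbove h] at hV
    exact hV.false
  obtain ⟨L, hL, h⟩ := exists_sum_le_of_optimal (Q := Q)
    (fun x => inputInfoVar W Q x - Vmax W) hdiv (by
    intro P hP hPQ
    have : condInfoVar W (outDist P W) P ≤ Vmax W := le_csSup hbdd ⟨P, hP, rfl⟩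
    rw [hPQ] at this
    simp_rw [mul_sub]
    rw [sum_sub_distrib, ← sum_mul, hP.1.2, one_mul]
    exact sub_nonpos.2 this)
  refine ⟨L, hL, fun n xs R hR hR0 => ?_⟩
  have := h n xs R hR hR0
  rw [sum_sub_distrib] at this
  simp only [sum_const, card_univ, Fintype.card_fin, nsmul_eq_mul] at this
  linarith

lemma exists_Vmin_le_sum_inputInfoVar (hW : IsChannel W) {Q : 𝒴 → ℝ}
    (hdiv : ∀ x, divX W Q x ≤ capacity W) :
    ∃ L : ℝ, 0 ≤ L ∧ ∀ (n : ℕ) (xs : Fin n → 𝒳) (R : ℝ),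
      (∀ y, |∑ k, (W (xs k) y - Q y)| ≤ R) → 0 ≤ R →
      n * Vmin W - L * (R + ∑ k, (capacity W - divX W Q (xs k))) ≤
        ∑ k, inputInfoVar W Q (xs k) := by
  have hbdd : BddBelow {v : ℝ | ∃ P : 𝒳 → ℝ, CapacityAchieving P W ∧
      v = condInfoVar W (outDist P W) P} := by
    refine ⟨0, ?_⟩
    rintro _ ⟨P, hP, rfl⟩
    exact sum_nonneg fun x _ => mul_nonneg (hP.1.1 x)
      (sum_nonneg fun y _ => mul_nonneg (hW.1 x y) (sq_nonneg _))
  obtain ⟨L, hL, h⟩ := exists_sum_le_of_optimal (Q := Q)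
    (fun x => Vmin W - inputInfoVar W Q x) hdiv (by
    intro P hP hPQ
    have : Vmin W ≤ condInfoVar W (outDist P W) P := csInf_le hbdd ⟨P, hP, rfl⟩
    rw [hPQ] at this
    simp_rw [mul_sub]
    rw [sum_sub_distrib, ← sum_mul, hP.1.2, one_mul]
    exact sub_nonpos.2 this)
  refine ⟨L, hL, fun n xs R hR hR0 => ?_⟩
  have := h n xs R hR hR0
  rw [sum_sub_distrib] at this
  simp only [sum_const, card_univ, Fintype.card_fin, nsmul_eq_mul] at this
  linarith

lemma exists_capacityAchieving {α : ℝ} (hV : 0 < Vdisp α W) :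
    ∃ P : 𝒳 → ℝ, CapacityAchieving P W := by
  by_contra! h
  have hempty : {v : ℝ | ∃ P : 𝒳 → ℝ, CapacityAchieving P W ∧
      v = condInfoVar W (outDist P W) P} = ∅ := by
    ext v; simp [h]
  rw [Vdisp, Vmin, Vmax, hempty] at hV
  simp at hV

end Channel

section Spectrum

variable {Z : Type*} [Fintype Z]

lemma mass_mono_threshold {p Q : Z → ℝ} (hp : ∀ z, 0 ≤ p z) (hQ : ∀ z, 0 ≤ Q z) {γ γ' : ℝ}
    (h : γ ≤ γ') :
    mass p {z | p z ≤ Real.exp γ * Q z} ≤ mass p {z | p z ≤ Real.exp γ' * Q z} := by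
  refine sum_le_sum fun z _ => Set.indicator_le_indicator_of_subset ?_ hp z
  intro z hz
  exact hz.trans (mul_le_mul_of_nonneg_right (Real.exp_le_exp.2 h) (hQ z))

lemma Ds_le_of_lt_mass {p Q : Z → ℝ} (hp : ∀ z, 0 ≤ p z) (hQ : ∀ z, 0 ≤ Q z) {α γ : ℝ}
    (hα : 0 ≤ α) (h : α < mass p {z | p z ≤ Real.exp γ * Q z}) : Ds α p Q ≤ γ := by
  refine csSup_le ?_ fun γ' hγ' => ?_
  · have hev : ∀ᶠ g in Filter.atBot, ∀ z, 0 < p z → Real.exp g * Q z < p z := by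
      rw [Filter.eventually_all]
      intro z
      by_cases hz : 0 < p z
      · have : Filter.Tendsto (fun g => Real.exp g * Q z) Filter.atBot (nhds 0) := by
          simpa using Real.tendsto_exp_atBot.mul_const (Q z)
        filter_upwards [this.eventually_lt_const hz] with g hg _ using hg
      · exact Filter.Eventually.of_forall fun g hg => (hz hg).elim
    obtain ⟨g, hg⟩ := hev.exists
    refine ⟨g, le_trans (le_of_eq ?_) hα⟩
    refine sum_eq_zero fun z _ => ?_
    by_cases hz : p z ≤ Real.exp g * Q z
    · rw [Set.indicator_of_mem (by exact hz)]
      by_contra hne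
      exact (hg z (lt_of_le_of_ne (hp z) (Ne.symm hne))).not_ge hz
    · exact Set.indicator_of_notMem (by exact hz) p
  · by_contra hlt
    exact ((mass_mono_threshold hp hQ (not_le.1 hlt).le).trans hγ').not_gt h

/-- A distribution dominating every member of a weighted finite family of distributions. -/
lemma exists_dominating_mixture {I : Type*} [Fintype I] [Nonempty I] {w : I → ℝ}
    (hw : ∀ i, 0 < w i) (hw1 : ∑ i, w i ≤ 1) {D : I → Z → ℝ} (hD : ∀ i, IsDist (D i)) :
    ∃ Q : Z → ℝ, IsDist Q ∧ ∀ i z, w i * D i z ≤ Q z := by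
  have hs : 0 < ∑ i, w i := sum_pos (fun i _ => hw i) univ_nonempty
  have hnn : ∀ i z, 0 ≤ w i * D i z := fun i z => mul_nonneg (hw i).le ((hD i).1 z)
  refine ⟨fun z => (∑ i, w i * D i z) / ∑ i, w i,
    ⟨fun z => div_nonneg (sum_nonneg fun i _ => hnn i z) hs.le, ?_⟩, fun i z => ?_⟩
  · rw [← sum_div, sum_comm]
    simp_rw [← mul_sum, (hD _).2, mul_one]
    exact div_self hs.ne'
  · rw [le_div_iff₀ hs]
    calc w i * D i z * ∑ i, w i ≤ w i * D i z * 1 := mul_le_mul_of_nonneg_left hw1 (hnn i z)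
      _ ≤ ∑ i, w i * D i z := by
        rw [mul_one]
        exact single_le_sum (f := fun i => w i * D i z) (fun i _ => hnn i z) (mem_univ i)

end Spectrum

lemma sub_two_mul_sq_le_log_one_add {u : ℝ} (hu : |u| ≤ 1 / 2) :
    u - 2 * u ^ 2 ≤ Real.log (1 + u) := by
  have h := abs_le.1 hu
  have hp : 0 < 1 + u := by linarith
  have h1 := Real.one_sub_inv_le_log_of_pos hp
  refine le_trans ?_ h1
  rw [← one_div, le_sub_iff_add_le, ← le_sub_iff_add_le', div_le_iff₀ hp]
  nlinarith [sq_nonneg u]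

lemma abs_log_one_add_le {u : ℝ} (hu : |u| ≤ 1 / 2) : |Real.log (1 + u)| ≤ 2 * |u| := by
  have h := abs_le.1 hu
  have h1 := sub_two_mul_sq_le_log_one_add hu
  have h2 := Real.log_le_sub_one_of_pos (show 0 < 1 + u by linarith)
  have h3 : u ^ 2 ≤ |u| * (1 / 2) := by
    rw [← sq_abs, sq]; exact mul_le_mul_of_nonneg_left hu (abs_nonneg u)
  rw [abs_le]
  constructor <;> linarith [le_abs_self u, neg_abs_le u, abs_nonneg u]

/-- Comparison of Gaussian deviations with perturbed variances. -/
lemma sqrt_mul_le_of_variance_bound {a X Y E : ℝ} (hY : 0 < Y) (hX : 0 ≤ X)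
    (h1 : 0 ≤ a → X ≤ Y + E) (h2 : a < 0 → Y - E ≤ X) (hE : 0 ≤ E) :
    Real.sqrt X * a ≤ Real.sqrt Y * a + |a| * E / Real.sqrt Y := by
  have hy := Real.sqrt_pos.2 hY
  have hx := Real.sqrt_nonneg X
  have hys := Real.sq_sqrt hY.le
  have hxs := Real.sq_sqrt hX
  have hEy : E / Real.sqrt Y * Real.sqrt Y = E := div_mul_cancel₀ _ hy.ne'
  have hEy0 : 0 ≤ E / Real.sqrt Y := by positivity
  rw [mul_div_assoc]
  rcases le_or_gt 0 a with ha | ha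
  · have : Real.sqrt X ≤ Real.sqrt Y + E / Real.sqrt Y := by
      apply Real.sqrt_le_iff.2 ⟨by positivity, ?_⟩
      nlinarith [h1 ha]
    rw [abs_of_nonneg ha]
    nlinarith
  · have : Real.sqrt Y - E / Real.sqrt Y ≤ Real.sqrt X := by
      by_contra hlt
      have h3 := not_le.1 hlt
      nlinarith [h2 ha]
    rw [abs_of_neg ha]
    nlinarith

lemma log_div_tilt {𝒳 𝒴 : Type*} {W : 𝒳 → 𝒴 → ℝ} {Q u : 𝒴 → ℝ} {x : 𝒳} {s : ℝ}
    (hac : ∀ y, 0 < W x y → 0 < Q y) (hu : ∀ y, |u y| ≤ s)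
    (hs : s ≤ 1 / 2) {y : 𝒴} (hy : 0 < W x y) :
    Real.log (W x y / (Q y * (1 + u y))) = Real.log (W x y / Q y) - Real.log (1 + u y) := by
  have h := (abs_le.1 ((hu y).trans hs)).1
  have h1 : 0 < 1 + u y := by linarith
  rw [← div_div, Real.log_div (div_pos hy (hac y hy)).ne' h1.ne']

section Tilting

variable {𝒳 𝒴 : Type*} [Fintype 𝒳] [Fintype 𝒴] {W : 𝒳 → 𝒴 → ℝ}

lemma abs_sum_mul_le {p : 𝒴 → ℝ} (hp : IsDist p) {g : 𝒴 → ℝ} {B : ℝ}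
    (h : ∀ y, 0 < p y → |g y| ≤ B) : |∑ y, p y * g y| ≤ B := by
  calc |∑ y, p y * g y| ≤ ∑ y, |p y * g y| := abs_sum_le_sum_abs _ _
    _ ≤ ∑ y, p y * B := by
        refine sum_le_sum fun y _ => ?_
        rw [abs_mul, abs_of_nonneg (hp.1 y)]
        rcases (hp.1 y).eq_or_lt with h0 | h0
        · simp [← h0]
        · exact mul_le_mul_of_nonneg_left (h y h0) h0.le
    _ = B := by rw [← sum_mul, hp.2, one_mul]

variable {Q u : 𝒴 → ℝ} {x : 𝒳} {s B : ℝ}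

lemma abs_log_div_tilt_le (hW : IsChannel W) (hac : ∀ y, 0 < W x y → 0 < Q y)
    (hu : ∀ y, |u y| ≤ s) (hs : s ≤ 1 / 2) (hB : ∀ y, |Real.log (W x y / Q y)| ≤ B) (y : 𝒴) :
    |Real.log (W x y / (Q y * (1 + u y)))| ≤ B + 1 := by
  rcases (hW.1 x y).eq_or_lt with h | h
  · have := (abs_nonneg _).trans (hB y)
    simp only [← h, zero_div, Real.log_zero, abs_zero]
    linarith
  · rw [log_div_tilt hac hu hs h]
    have h1 := abs_log_one_add_le ((hu y).trans hs)
    have h2 := abs_sub (Real.log (W x y / Q y)) (Real.log (1 + u y))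
    linarith [hB y, hu y]

lemma divX_tilt_eq (hW : IsChannel W) (hac : ∀ y, 0 < W x y → 0 < Q y) (hu : ∀ y, |u y| ≤ s)
    (hs : s ≤ 1 / 2) :
    divX W (fun y => Q y * (1 + u y)) x = divX W Q x - ∑ y, W x y * Real.log (1 + u y) := by
  unfold divX
  rw [← sum_sub_distrib]
  refine sum_congr rfl fun y _ => ?_
  rcases (hW.1 x y).eq_or_lt with h | h
  · simp [← h]
  · rw [log_div_tilt hac hu hs h]; ring

lemma divX_tilt_le (hW : IsChannel W) (hac : ∀ y, 0 < W x y → 0 < Q y) (hu : ∀ y, |u y| ≤ s)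
    (hs : s ≤ 1 / 2) :
    divX W (fun y => Q y * (1 + u y)) x ≤ divX W Q x - ∑ y, W x y * u y + 2 * s ^ 2 := by
  rw [divX_tilt_eq hW hac hu hs]
  have : ∑ y, W x y * (u y - 2 * s ^ 2) ≤ ∑ y, W x y * Real.log (1 + u y) := by
    refine sum_le_sum fun y _ => mul_le_mul_of_nonneg_left ?_ (hW.1 x y)
    refine le_trans ?_ (sub_two_mul_sq_le_log_one_add ((hu y).trans hs))
    have h1 := abs_le.1 (hu y)
    have := sq_le_sq' h1.1 h1.2
    linarith
  simp_rw [mul_sub] at this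
  rw [sum_sub_distrib, ← sum_mul, hW.2, one_mul] at this
  linarith

lemma abs_inputInfoVar_tilt_sub_le (hW : IsChannel W) (hac : ∀ y, 0 < W x y → 0 < Q y)
    (hu : ∀ y, |u y| ≤ s) (hs : s ≤ 1 / 2) (hB : ∀ y, |Real.log (W x y / Q y)| ≤ B) :
    |inputInfoVar W (fun y => Q y * (1 + u y)) x - inputInfoVar W Q x| ≤ s * (16 * B + 8) := by
  have hd : |divX W Q x| ≤ B := abs_sum_mul_le (hW.isDist x) fun y _ => hB y
  have hl : ∀ y, |Real.log (1 + u y)| ≤ 2 * s := fun y =>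
    (abs_log_one_add_le ((hu y).trans hs)).trans (by linarith [hu y])
  have hm : |∑ y, W x y * Real.log (1 + u y)| ≤ 2 * s :=
    abs_sum_mul_le (hW.isDist x) fun y _ => hl y
  unfold inputInfoVar
  rw [divX_tilt_eq hW hac hu hs, ← sum_sub_distrib]
  simp_rw [← mul_sub]
  refine abs_sum_mul_le (hW.isDist x) fun y hy => ?_
  rw [log_div_tilt hac hu hs hy]
  set f := Real.log (W x y / Q y)
  set d := divX W Q x
  set l := Real.log (1 + u y)
  set m := ∑ y, W x y * Real.log (1 + u y)
  have e : (f - l - (d - m)) ^ 2 - (f - d) ^ 2 = (m - l) * (2 * (f - d) + (m - l)) := by ring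
  rw [e, abs_mul]
  have h1 : |m - l| ≤ 4 * s := (abs_sub _ _).trans (by linarith [hl y])
  have h2 : |2 * (f - d) + (m - l)| ≤ 4 * B + 2 := by
    have h3 : |f - d| ≤ 2 * B := (abs_sub _ _).trans (by linarith [hB y])
    have h4 := abs_add_le (2 * (f - d)) (m - l)
    rw [abs_mul, abs_two] at h4
    linarith
  calc |m - l| * |2 * (f - d) + (m - l)| ≤ 4 * s * (4 * B + 2) :=
        mul_le_mul h1 h2 (abs_nonneg _) ((abs_nonneg _).trans h1)
    _ = s * (16 * B + 8) := by ring

/-- Gaussian deviation at an input sequence compared with the one at optimal inputs. -/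
lemma exists_sqrt_variance_mul_le (hW : IsChannel W) (hdiv : ∀ x, divX W Q x ≤ capacity W)
    {α a : ℝ} (ha : stdPhi a = α) (hV : 0 < Vdisp α W) :
    ∃ L : ℝ, 0 ≤ L ∧ ∀ (n : ℕ) (xs : Fin n → 𝒳) (R X E : ℝ), 1 ≤ n →
      (∀ y, |∑ k, (W (xs k) y - Q y)| ≤ R) → 0 ≤ R → 0 ≤ X →
      |X - ∑ k, inputInfoVar W Q (xs k)| ≤ E →
      Real.sqrt X * a ≤ Real.sqrt (n * Vdisp α W) * a +
        |a| * (L * (R + ∑ k, (capacity W - divX W Q (xs k))) + E) /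
          Real.sqrt (n * Vdisp α W) := by
  have hG : ∀ (n : ℕ) (xs : Fin n → 𝒳), 0 ≤ ∑ k, (capacity W - divX W Q (xs k)) :=
    fun n xs => sum_nonneg fun k _ => sub_nonneg.2 (hdiv _)
  by_cases hα : α < 1 / 2
  · have ha0 : a < 0 := by
      rw [← ha, ← stdPhi_zero] at hα
      exact strictMono_stdPhi.lt_iff_lt.1 hα
    obtain ⟨L, hL, h⟩ := exists_Vmin_le_sum_inputInfoVar hW hdiv
    refine ⟨L, hL, fun n xs R X E hn hR hR0 hX hE => ?_⟩
    have hn' : (0 : ℝ) < n := by exact_mod_cast hn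
    refine sqrt_mul_le_of_variance_bound (by positivity) hX (fun h0 => absurd ha0 (not_lt.2 h0))
      (fun _ => ?_) (by have := hG n xs; have := (abs_nonneg _).trans hE; positivity)
    have h1 := h n xs R hR hR0
    rw [Vdisp, if_pos hα]
    linarith [(abs_le.1 hE).1]
  · have ha0 : 0 ≤ a := by
      rw [← ha, ← stdPhi_zero] at hα
      exact strictMono_stdPhi.le_iff_le.1 (not_lt.1 hα)
    have hV' : 0 < Vmax W := by rwa [Vdisp, if_neg hα] at hV
    obtain ⟨L, hL, h⟩ := exists_sum_inputInfoVar_le_Vmax hdiv hV'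
    refine ⟨L, hL, fun n xs R X E hn hR hR0 hX hE => ?_⟩
    have hn' : (0 : ℝ) < n := by exact_mod_cast hn
    refine sqrt_mul_le_of_variance_bound (by positivity) hX
      (fun _ => ?_) (fun h0 => absurd h0 (not_lt.2 ha0))
      (by have := hG n xs; have := (abs_nonneg _).trans hE; positivity)
    have h1 := h n xs R hR hR0
    rw [Vdisp, if_neg hα]
    linarith [(abs_le.1 hE).2]

end Tilting

section OutputDistribution

variable {𝒳 𝒴 : Type*} [Fintype 𝒳] [Fintype 𝒴]

/-- Signed perturbation direction concentrated at the letter `i`, centered under `Q`. -/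
noncomputable def tiltDir [DecidableEq 𝒴] (Q : 𝒴 → ℝ) (i : 𝒴) (b : Bool) (y : 𝒴) : ℝ :=
  (if b then 1 else -1) * ((if y = i then 1 else 0) - Q i)

lemma abs_tiltDir_le [DecidableEq 𝒴] {Q : 𝒴 → ℝ} (hQ : IsDist Q) (i : 𝒴) (b : Bool) (y : 𝒴) :
    |tiltDir Q i b y| ≤ 1 := by
  have h0 := hQ.1 i
  have h1 := hQ.le_one i
  unfold tiltDir
  rw [abs_le]
  constructor <;> split_ifs <;> linarith

lemma sum_mul_tiltDir [DecidableEq 𝒴] {p Q : 𝒴 → ℝ} (hp : IsDist p) (i : 𝒴) (b : Bool) :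
    ∑ y, p y * tiltDir Q i b y = (if b then 1 else -1) * (p i - Q i) := by
  unfold tiltDir
  simp_rw [mul_left_comm (p _), ← mul_sum, mul_sub, sum_sub_distrib, ← sum_mul, hp.2]
  cases b <;> simp [sub_eq_neg_add, add_comm]

lemma isDist_tilt [DecidableEq 𝒴] {Q : 𝒴 → ℝ} (hQ : IsDist Q) (i : 𝒴) (b : Bool) {s : ℝ}
    (hs0 : 0 ≤ s) (hs : s ≤ 1) : IsDist fun y => Q y * (1 + s * tiltDir Q i b y) := by
  refine ⟨fun y => mul_nonneg (hQ.1 y) ?_, ?_⟩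
  · have := (abs_le.1 (abs_tiltDir_le hQ i b y)).1
    nlinarith
  · simp_rw [mul_add, mul_one, mul_left_comm (Q _), sum_add_distrib, ← mul_sum,
      sum_mul_tiltDir hQ, hQ.2]
    ring

lemma sum_half_pow_succ_le (m : ℕ) : ∑ j : Fin m, (1 / 2 : ℝ) ^ ((j : ℕ) + 1) ≤ 1 := by
  rw [Fin.sum_univ_eq_sum_range fun j => (1 / 2 : ℝ) ^ (j + 1)]
  have : ∑ j ∈ range m, (1 / 2 : ℝ) ^ (j + 1) = 1 - (1 / 2) ^ m := by
    induction m with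
    | zero => simp
    | succ k ih => rw [sum_range_succ, ih]; ring
  rw [this]
  have : (0 : ℝ) ≤ (1 / 2) ^ m := by positivity
  linarith

/-- A single distribution on sequences dominating the product distributions of all tilts
up to a factor exponential in the size of the tilt. -/
lemma exists_dominating_tilts [DecidableEq 𝒴] [Nonempty 𝒴] {Q : 𝒴 → ℝ} (hQ : IsDist Q)
    (n : ℕ) {m : ℕ} {r : ℝ} (hr : 0 < r) (hm : (m : ℝ) ≤ r) :
    ∃ Qn : (Fin n → 𝒴) → ℝ, IsDist Qn ∧ ∀ j, j ≤ m → ∀ i b ω,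
      (1 / 2 : ℝ) ^ (j + 1) / (2 * Fintype.card 𝒴) *
        prodWeight (fun (_ : Fin n) y => Q y * (1 + j / r * tiltDir Q i b y)) ω ≤ Qn ω := by
  have hc : (0 : ℝ) < Fintype.card 𝒴 := by exact_mod_cast Fintype.card_pos
  have hw1 : ∑ i : Fin (m + 1) × 𝒴 × Bool,
      (1 / 2 : ℝ) ^ ((i.1 : ℕ) + 1) / (2 * Fintype.card 𝒴) ≤ 1 := by
    rw [Fintype.sum_prod_type]
    simp only [sum_const, card_univ, Fintype.card_prod, Fintype.card_bool, nsmul_eq_mul]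
    refine le_trans (le_of_eq (sum_congr rfl fun j _ => ?_)) (sum_half_pow_succ_le (m + 1))
    push_cast
    field_simp
  have hD : ∀ i : Fin (m + 1) × 𝒴 × Bool, IsDist (prodWeight fun (_ : Fin n) y =>
      Q y * (1 + ((i.1 : ℕ) : ℝ) / r * tiltDir Q i.2.1 i.2.2 y)) := by
    rintro ⟨j, i, b⟩
    have hj : ((j : ℕ) : ℝ) ≤ m := by exact_mod_cast Nat.le_of_lt_succ j.2
    have hd : ∀ _ : Fin n, IsDist fun y => Q y * (1 + ((j : ℕ) : ℝ) / r * tiltDir Q i b y) :=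
      fun _ => isDist_tilt hQ i b (by positivity) ((div_le_one hr).2 (hj.trans hm))
    exact ⟨prodWeight_nonneg hd, sum_prodWeight hd⟩
  obtain ⟨Qn, hQn, h⟩ := exists_dominating_mixture (fun i => by positivity) hw1 hD
  exact ⟨Qn, hQn, fun j hj i b ω => h (⟨j, Nat.lt_succ_of_le hj⟩, i, b) ω⟩

/-- Tail bound for the centered information density, converted to a bound on the information
spectrum divergence. -/
lemma Ds_prodChannel_le {W : 𝒳 → 𝒴 → ℝ} (hW : IsChannel W) {n : ℕ} (xs : Fin n → 𝒳) {T : 𝒴 → ℝ}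
    (hT : IsDist T) (hac : ∀ x y, 0 < W x y → 0 < T y) {Qn : (Fin n → 𝒴) → ℝ} (hQn : ∀ ω, 0 ≤ Qn ω)
    {w : ℝ} (hw : 0 < w) (hdom : ∀ ω, w * prodWeight (fun _ : Fin n => T) ω ≤ Qn ω) {β t : ℝ}
    (hβ : 0 ≤ β)
    (h : β < ∑ ω, prodWeight (fun k => W (xs k)) ω *
      (if ∑ k, (Real.log (W (xs k) (ω k) / T (ω k)) - divX W T (xs k)) ≤ t then 1 else 0)) :
    Ds β (prodChannel W n xs) Qn ≤ t + ∑ k, divX W T (xs k) - Real.log w := by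
  have hp : ∀ ω, 0 ≤ prodChannel W n xs ω := prodWeight_nonneg fun k => hW.isDist (xs k)
  refine Ds_le_of_lt_mass hp hQn hβ (h.trans_le (sum_le_sum fun ω _ => ?_))
  have hind := Set.indicator_nonneg (s := {z | prodChannel W n xs z ≤
    Real.exp (t + ∑ k, divX W T (xs k) - Real.log w) * Qn z}) (fun z _ => hp z) ω
  split_ifs with ht
  swap
  · simpa using hind
  rw [mul_one]
  rcases (hp ω).eq_or_lt with h0 | h0
  · exact (le_of_eq (show prodWeight (fun k => W (xs k)) ω = 0 from h0.symm)).trans hind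
  have hWpos : ∀ k, 0 < W (xs k) (ω k) := fun k =>
    lt_of_le_of_ne (hW.1 _ _) fun he => h0.ne' (prod_eq_zero (mem_univ k) he.symm)
  rw [Set.indicator_of_mem]
  · exact le_rfl
  have hTn : 0 ≤ prodWeight (fun _ : Fin n => T) ω := prodWeight_nonneg (fun _ => hT) ω
  have heq : prodChannel W n xs ω =
      Real.exp (∑ k, Real.log (W (xs k) (ω k) / T (ω k))) * prodWeight (fun _ : Fin n => T) ω := by
    rw [Real.exp_sum]
    unfold prodChannel prodWeight
    rw [← prod_mul_distrib]
    refine prod_congr rfl fun k _ => ?_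
    have hk := hac _ _ (hWpos k)
    rw [Real.exp_log (div_pos (hWpos k) hk), div_mul_cancel₀ _ hk.ne']
  rw [sum_sub_distrib] at ht
  show prodChannel W n xs ω ≤ _
  rw [heq]
  calc _ ≤ Real.exp (t + ∑ k, divX W T (xs k)) * prodWeight (fun _ : Fin n => T) ω :=
        mul_le_mul_of_nonneg_right (Real.exp_le_exp.2 (by linarith)) hTn
    _ = Real.exp (t + ∑ k, divX W T (xs k) - Real.log w) *
          (w * prodWeight (fun _ : Fin n => T) ω) := by
        rw [Real.exp_sub, Real.exp_log hw]; field_simp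
    _ ≤ _ := mul_le_mul_of_nonneg_left (hdom ω) (Real.exp_pos _).le

lemma tilt_tradeoff_le {A G r ρ : ℝ} {j : ℕ} (hG : 0 ≤ G) (hr : 0 < r) (hAr : A ≤ r)
    (hj : (j : ℝ) ≤ ρ / 4) (hj1 : ρ / 4 < j + 1) :
    A * (ρ + G / r) - G - j * ρ + 2 * (j : ℝ) ^ 2 + (j + 1) * Real.log 2 ≤
      Real.log 2 + 2 * (A + 1) ^ 2 := by
  have hj0 : (0 : ℝ) ≤ j := Nat.cast_nonneg j
  have hρ : 0 ≤ ρ := by linarith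
  have h1 : A * (G / r) ≤ G := by
    rw [← mul_div_assoc, div_le_iff₀ hr, mul_comm G]
    exact mul_le_mul_of_nonneg_right hAr hG
  have h2 : (j : ℝ) * Real.log 2 ≤ ρ / 4 := by
    have hl : Real.log 2 ≤ 1 := by linarith [Real.log_two_lt_d9]
    nlinarith
  have h3 : (j : ℝ) * (2 * j - ρ) ≤ -(ρ / 4 - 1) * (ρ / 2) := by nlinarith
  nlinarith [sq_nonneg (ρ - 4 * (A + 1))]

lemma exists_signed_max [Nonempty 𝒴] (f : 𝒴 → ℝ) :
    ∃ (i : 𝒴) (b : Bool), ∀ y, |f y| ≤ (if b then 1 else -1) * f i := by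
  obtain ⟨i, hi⟩ := Finite.exists_max fun y => |f y|
  rcases abs_choice (f i) with h | h
  · exact ⟨i, true, fun y => by simpa [h] using hi y⟩
  · exact ⟨i, false, fun y => by simpa [h] using hi y⟩

lemma sum_divX_tilt_le [DecidableEq 𝒴] {W : 𝒳 → 𝒴 → ℝ} (hW : IsChannel W) {Q : 𝒴 → ℝ}
    (hac : ∀ x y, 0 < W x y → 0 < Q y) {n : ℕ} (xs : Fin n → 𝒳) (i : 𝒴) (b : Bool)
    {s : ℝ} (hu : ∀ y, |s * tiltDir Q i b y| ≤ s) (hs : s ≤ 1 / 2) :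
    ∑ k, divX W (fun y => Q y * (1 + s * tiltDir Q i b y)) (xs k) ≤
      ∑ k, divX W Q (xs k) - s * ((if b then 1 else -1) * ∑ k, (W (xs k) i - Q i)) +
        n * (2 * s ^ 2) := by
  refine (sum_le_sum fun k _ => divX_tilt_le hW (hac (xs k)) hu hs).trans (le_of_eq ?_)
  simp_rw [mul_left_comm (W _ _), ← mul_sum, sum_mul_tiltDir (hW.isDist _)]
  rw [sum_add_distrib, sum_sub_distrib, sum_const, card_univ, Fintype.card_fin, nsmul_eq_mul,
    ← mul_sum, ← mul_sum]

end OutputDistribution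

/-- Output distribution for the second-order converse (Lemma 5): a good
common output distribution `Q_n` bounding the symbol-wise information spectrum
divergence. -/
theorem second_order_output_distribution
    {𝒳 𝒴 : Type*} [Fintype 𝒳] [Fintype 𝒴]
    (W : 𝒳 → 𝒴 → ℝ) (hW : IsChannel W)
    (ε δ : ℝ) (hε : 0 < ε) (hε1 : ε < 1) (hδ : 0 < δ) (hδ1 : δ < 1)
    (hsum : ε + δ < 1) (hV : 0 < Vdisp (ε + δ) W)
    (a : ℝ) (ha : stdPhi a = ε + δ) :
    ∃ F : ℝ, 0 < F ∧ ∃ n₀ : ℕ, ∀ n, n₀ ≤ n →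
      ∃ Q : (Fin n → 𝒴) → ℝ, IsDist Q ∧
        ∀ xs : Fin n → 𝒳,
          Ds (ε + δ + 1 / Real.sqrt n) (prodChannel W n xs) Q ≤
            n * capacity W + Real.sqrt (n * Vdisp (ε + δ) W) * a + F := by
  classical
  obtain ⟨P, hP⟩ := exists_capacityAchieving hV
  set Q := outDist P W with hQdef
  have hQ : IsDist Q := isDist_outDist hP.1 hW
  have : Nonempty 𝒴 := by
    by_contra hne
    rw [not_nonempty_iff] at hne
    simpa using hQ.2
  have hac : ∀ x y, 0 < W x y → 0 < Q y := fun x y h =>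
    outDist_pos_of_capacityAchieving hW hP h
  have hdiv : ∀ x, divX W Q x ≤ capacity W := divX_le_capacity hW hP
  obtain ⟨B, hB0, hB⟩ : ∃ B : ℝ, 0 ≤ B ∧ ∀ x y, |Real.log (W x y / Q y)| ≤ B := by
    refine ⟨∑ x, ∑ y, |Real.log (W x y / Q y)|,
      sum_nonneg fun x _ => sum_nonneg fun y _ => abs_nonneg _, fun x y => ?_⟩
    exact (single_le_sum (f := fun y => |Real.log (W x y / Q y)|) (fun y _ => abs_nonneg _)
      (mem_univ y)).trans (single_le_sum (f := fun x => ∑ y, |Real.log (W x y / Q y)|)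
        (fun x _ => sum_nonneg fun y _ => abs_nonneg _) (mem_univ x))
  obtain ⟨F₀, hF₀, n₁, hquant⟩ :=
    exists_quantile_shift (Y := 𝒴) ha hsum (show 0 < 2 * (B + 1) by positivity)
  obtain ⟨L, hL, hdev⟩ := exists_sqrt_variance_mul_le hW hdiv ha hV
  set V := Vdisp (ε + δ) W with hVdef
  have hsV : 0 < Real.sqrt V := Real.sqrt_pos.2 hV
  set A := |a| * (L + 16 * B + 8) / Real.sqrt V with hAdef
  have hc : (1 : ℝ) ≤ Fintype.card 𝒴 := by exact_mod_cast Fintype.card_pos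
  have hlc : 0 < Real.log (2 * Fintype.card 𝒴) := Real.log_pos (by linarith)
  have hl2 : 0 < Real.log 2 := Real.log_pos (by norm_num)
  refine ⟨F₀ + Real.log (2 * Fintype.card 𝒴) + (Real.log 2 + 2 * (A + 1) ^ 2), by positivity,
    max n₁ (max 1 ⌈A ^ 2⌉₊), fun n hn => ?_⟩
  have hn₁ : n₁ ≤ n := (le_max_left _ _).trans hn
  have hn1 : 1 ≤ n := ((le_max_left _ _).trans (le_max_right _ _)).trans hn
  have hnA : A ^ 2 ≤ n :=
    Nat.ceil_le.1 (((le_max_right _ _).trans (le_max_right _ _)).trans hn)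
  have hn0 : (0 : ℝ) < n := by exact_mod_cast hn1
  set r := Real.sqrt n with hrdef
  have hr : 0 < r := Real.sqrt_pos.2 hn0
  have hrr : r ^ 2 = n := Real.sq_sqrt hn0.le
  have hAr : A ≤ r := Real.le_sqrt_of_sq_le hnA
  have hm : ((⌊r / 4⌋₊ : ℕ) : ℝ) ≤ r := (Nat.floor_le (by positivity)).trans (by linarith)
  obtain ⟨Qn, hQn, hdom⟩ := exists_dominating_tilts hQ n hr hm
  refine ⟨Qn, hQn, fun xs => ?_⟩
  obtain ⟨i, b, hmax⟩ := exists_signed_max fun y => ∑ k, (W (xs k) y - Q y)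
  set R := (if b then (1 : ℝ) else -1) * ∑ k, (W (xs k) i - Q i) with hRdef
  have hR0 : 0 ≤ R := (abs_nonneg _).trans (hmax i)
  have hRn : R ≤ n := by
    have h1 : |∑ k, (W (xs k) i - Q i)| ≤ n := by
      refine (abs_sum_le_sum_abs _ _).trans ?_
      calc ∑ k, |W (xs k) i - Q i| ≤ ∑ _k : Fin n, (1 : ℝ) := by
            refine sum_le_sum fun k _ => ?_
            have h1 := hW.1 (xs k) i
            have h2 := (hW.isDist (xs k)).le_one i
            have h3 := hQ.1 i
            have h4 := hQ.le_one i
            rw [abs_le]; constructor <;> linarith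
        _ = n := by simp
    have h2 := abs_le.1 h1
    rw [hRdef]
    split_ifs <;> linarith
  set ρ := R / r with hρdef
  have hρr : ρ * r = R := div_mul_cancel₀ _ hr.ne'
  have hρ0 : 0 ≤ ρ := by positivity
  have hρle : ρ ≤ r := by rw [hρdef, div_le_iff₀ hr, ← sq, hrr]; exact hRn
  set j := ⌊ρ / 4⌋₊ with hjdef
  have hj : (j : ℝ) ≤ ρ / 4 := Nat.floor_le (by positivity)
  have hj1 : ρ / 4 < j + 1 := Nat.lt_floor_add_one _
  have hjm : j ≤ ⌊r / 4⌋₊ := Nat.floor_le_floor (by linarith)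
  set s := (j : ℝ) / r with hsdef
  have hsr : s * r = j := div_mul_cancel₀ _ hr.ne'
  have hs0 : 0 ≤ s := by positivity
  have hs : s ≤ 1 / 2 := by rw [hsdef, div_le_iff₀ hr]; linarith
  have hu : ∀ y, |s * tiltDir Q i b y| ≤ s := fun y => by
    rw [abs_mul, abs_of_nonneg hs0]
    exact mul_le_of_le_one_right hs0 (abs_tiltDir_le hQ i b y)
  set T : 𝒴 → ℝ := fun y => Q y * (1 + s * tiltDir Q i b y) with hTdef
  have hT : IsDist T := isDist_tilt hQ i b hs0 (by linarith)
  have hacT : ∀ x y, 0 < W x y → 0 < T y := fun x y h =>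
    mul_pos (hac x y h) (by linarith [(abs_le.1 (hu y)).1])
  set G := ∑ k, (capacity W - divX W Q (xs k)) with hGdef
  have hG : 0 ≤ G := sum_nonneg fun k _ => sub_nonneg.2 (hdiv _)
  have hGeq : ∑ k, divX W Q (xs k) = n * capacity W - G := by
    rw [hGdef, sum_sub_distrib]; simp
  set X := ∑ k, inputInfoVar W T (xs k) with hXdef
  have hlogT : ∀ x y, |Real.log (W x y / T y)| ≤ B + 1 := fun x y =>
    abs_log_div_tilt_le hW (hac x) hu hs (hB x) y
  have hX0 : 0 ≤ X := sum_nonneg fun k _ => sum_nonneg fun y _ =>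
    mul_nonneg (hW.1 _ _) (sq_nonneg _)
  have hXE : |X - ∑ k, inputInfoVar W Q (xs k)| ≤ R * (16 * B + 8) := by
    rw [hXdef, ← sum_sub_distrib]
    calc |∑ k, (inputInfoVar W T (xs k) - inputInfoVar W Q (xs k))|
        ≤ ∑ _k : Fin n, s * (16 * B + 8) := (abs_sum_le_sum_abs _ _).trans
          (sum_le_sum fun k _ => abs_inputInfoVar_tilt_sub_le hW (hac _) hu hs (hB _))
      _ = (n * s) * (16 * B + 8) := by simp [mul_assoc]
      _ ≤ R * (16 * B + 8) := by
        refine mul_le_mul_of_nonneg_right ?_ (by positivity)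
        calc n * s = j * r := by rw [← hrr, ← hsr]; ring
          _ ≤ ρ * r := mul_le_mul_of_nonneg_right (by linarith) hr.le
          _ = R := hρr
  have hq := hquant n hn₁ (fun k => W (xs k))
    (fun k y => Real.log (W (xs k) y / T y) - divX W T (xs k)) (fun k => hW.isDist _)
    (fun k => by
      simp_rw [mul_sub, sum_sub_distrib, ← sum_mul, hW.2, one_mul]
      exact sub_self _)
    (fun k y => by
      have h1 : |divX W T (xs k)| ≤ B + 1 := abs_sum_mul_le (hW.isDist _) fun y _ => hlogT _ y
      exact (abs_sub _ _).trans (by linarith [hlogT (xs k) y]))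
  have hw : (0 : ℝ) < (1 / 2) ^ (j + 1) / (2 * Fintype.card 𝒴) := by positivity
  have hDs := Ds_prodChannel_le hW xs hT hacT hQn.1 hw (hdom j hjm i b)
    (show 0 ≤ ε + δ + 1 / r by positivity) hq
  refine hDs.trans ?_
  have hlogw : Real.log ((1 / 2 : ℝ) ^ (j + 1) / (2 * Fintype.card 𝒴)) =
      -((j + 1) * Real.log 2) - Real.log (2 * Fintype.card 𝒴) := by
    rw [Real.log_div (by positivity) (by positivity), Real.log_pow, one_div, Real.log_inv]
    push_cast
    ring
  have hsum' := sum_divX_tilt_le hW hac xs i b hu hs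
  have hsR : s * R = j * ρ := by rw [← hρr, ← hsr]; ring
  have hns : n * (2 * s ^ 2) = 2 * (j : ℝ) ^ 2 := by rw [← hrr, ← hsr]; ring
  have hdev' := hdev n xs R X (R * (16 * B + 8)) hn1 hmax hR0 hX0 hXE
  have hAe : |a| * (L * (R + G) + R * (16 * B + 8)) / Real.sqrt (n * V) ≤ A * (ρ + G / r) := by
    rw [Real.sqrt_mul hn0.le, hAdef, hρdef, ← add_div, div_mul_div_comm, mul_comm r]
    refine div_le_div_of_nonneg_right ?_ (by positivity)
    rw [mul_assoc |a|]
    refine mul_le_mul_of_nonneg_left ?_ (abs_nonneg a)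
    have : 0 ≤ G * (16 * B + 8) := by positivity
    linarith
  have htr := tilt_tradeoff_le (A := A) hG hr hAr hj hj1
  rw [hlogw]
  change Real.sqrt X * a + F₀ + ∑ k, divX W T (xs k) - _ ≤ _
  rw [← hRdef, hsR, hns, hGeq] at hsum'
  linarith
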